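/- arXiv:2310.12896 — 4 statements merged into one kernel-verified Lean document; each statement's English description precedes it below -/
import Mathlib

section
/- Then IF = FE; that is, dist(I,F) = dist(F,E). -/
open EuclideanGeometry Real RealInnerProductSpace Affine

/-- The Euclidean plane. -/
abbrev Plane := EuclideanSpace ℝ (Fin 2)

theorem aj_dist_sq (P Q : Plane) : dist P Q ^ 2 = (P 0 - Q 0)^2 + (P 1 - Q 1)^2 := by
  rw [EuclideanSpace.dist_eq, Real.sq_sqrt (by positivity)]
  simp [Fin.sum_univ_two, Real.dist_eq, sq_abs]

theorem aj_line {P X Y : Plane} (h : P ∈ affineSpan ℝ ({X, Y} : Set Plane)) :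
    ∃ t : ℝ, ∀ i, P i = X i + t * (Y i - X i) := by
  rw [mem_affineSpan_pair_iff_exists_lineMap_eq] at h
  obtain ⟨t, rfl⟩ := h
  refine ⟨t, fun i => ?_⟩
  simp [AffineMap.lineMap_apply]
  ring

theorem aj_infDist {P X Y : Plane} {r : ℝ} (hXY : X ≠ Y)
    (h : Metric.infDist P (affineSpan ℝ ({X, Y} : Set Plane) : Set Plane) = r) :
    r * dist X Y = |(Y 0 - X 0) * (P 1 - X 1) - (Y 1 - X 1) * (P 0 - X 0)| := by
  have hd : 0 < dist X Y := dist_pos.mpr hXY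
  have hd2 := aj_dist_sq X Y
  set d := dist X Y with hdd
  set S := (Y 0 - X 0) * (P 1 - X 1) - (Y 1 - X 1) * (P 0 - X 0) with hS
  suffices hr : r = |S| / d by rw [hr]; field_simp
  rw [← h]
  apply le_antisymm
  · set t := ((Y 0 - X 0) * (P 0 - X 0) + (Y 1 - X 1) * (P 1 - X 1)) / d^2 with ht
    have htd : t * d^2 = (Y 0 - X 0) * (P 0 - X 0) + (Y 1 - X 1) * (P 1 - X 1) := by
      rw [ht]; field_simp
    refine (Metric.infDist_le_dist_of_mem
      (AffineMap.lineMap_mem_affineSpan_pair t X Y)).trans ?_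
    apply (sq_le_sq₀ dist_nonneg (by positivity)).mp
    rw [aj_dist_sq, div_pow, sq_abs, le_div_iff₀ (by positivity)]
    apply le_of_eq
    simp [AffineMap.lineMap_apply]
    rw [hS]
    have e : ((P 0 - (t * (Y 0 - X 0) + X 0)) ^ 2 + (P 1 - (t * (Y 1 - X 1) + X 1)) ^ 2) * d ^ 2
      = ((P 0 - X 0)^2 + (P 1 - X 1)^2) * d^2 - 2 * (t*d^2) * ((Y 0 - X 0) * (P 0 - X 0) + (Y 1 - X 1) * (P 1 - X 1)) + (t * d^2) * t * ((X 0 - Y 0)^2 + (X 1 - Y 1)^2) := by ring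
    rw [e, ← hd2]
    have e2 : t * d^2 * t * d^2 = (t * d^2)^2 := by ring
    rw [e2, htd, hd2]
    ring
  · refine (Metric.le_infDist ⟨X, left_mem_affineSpan_pair ℝ X Y⟩).mpr ?_
    intro Q hQ
    obtain ⟨t, ht⟩ := aj_line hQ
    apply (sq_le_sq₀ (by positivity) dist_nonneg).mp
    rw [aj_dist_sq, div_pow, sq_abs, div_le_iff₀ (by positivity), hd2, ht 0, ht 1, hS]
    nlinarith [sq_nonneg ((Y 0 - X 0) * (P 0 - (X 0 + t * (Y 0 - X 0))) + (Y 1 - X 1) * (P 1 - (X 1 + t * (Y 1 - X 1))))]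

theorem aj_hull {P A B C : Plane} (h : P ∈ convexHull ℝ ({A, B, C} : Set Plane)) :
    ∃ β γ : ℝ, 0 ≤ β ∧ 0 ≤ γ ∧ β + γ ≤ 1 ∧
      ∀ i, P i = A i + β * (B i - A i) + γ * (C i - A i) := by
  rw [convexHull_insert (by simp), convexHull_pair] at h
  simp only [convexJoin_singleton_left, Set.mem_iUnion] at h
  obtain ⟨Q, ⟨u, v, hu, hv, huv, rfl⟩, ⟨w, z, hw, hz, hwz, rfl⟩⟩ := h
  refine ⟨z * u, z * v, by positivity, by positivity, ?_, fun i => ?_⟩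
  · rw [← mul_add, huv]; linarith
  · have : w = 1 - z := by linarith
    have : u = 1 - v := by linarith
    subst_vars
    simp
    ring

set_option maxHeartbeats 2000000 in
theorem aj_core (a b c x y j o1 o2 R ix iy k u : ℝ)
    (ha : 0 < a) (hb : 0 < b) (hc : 0 < c) (hy : 0 < y) (hR : 0 < R) (hu : 0 ≤ u)
    (hj : 0 < j) (hjb : j < b) (hk : 0 < k) (hk2 : k * (b + c) ≤ a + b + c)
    (hc2 : x^2 + y^2 = c^2) (ha2 : (x-b)^2 + y^2 = a^2) (hu2 : (x-j)^2 + y^2 = u^2)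
    (hBo : (x-o1)^2 + (y-o2)^2 = R^2) (hCo : (b-o1)^2 + o2^2 = R^2)
    (hJo : (j-o1)^2 + o2^2 = R^2)
    (hix : (a+b+c) * ix = b * (c + x)) (hiy : (a+b+c) * iy = b * y)
    (hD : (o1 - k * ix)^2 + (o2 - k * iy)^2 = (R + k * iy)^2) :
    k * (c + x) = c + j - u := by
  have ho1 : 2 * o1 = j + b := by
    have : (b - j) * (2 * o1 - (j + b)) = 0 := by nlinarith
    rcases mul_eq_zero.mp this with h | h <;> linarith
  have ho2 : 2 * y * o2 = c^2 - x * (j+b) + j*b := by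
    have : o1 = (j+b)/2 := by linarith
    subst this
    nlinarith
  have hRu : 2 * y * R = u * a := by
    apply (sq_eq_sq₀ (by positivity) (by positivity)).mp
    have e1 : (2*y*R)^2 = y^2*(2*o1 - 2*j)^2 + (2*y*o2)^2 := by
      linear_combination (-4*y^2) * hJo
    rw [e1, ho1, ho2, mul_pow, ← hu2, ← ha2, ← hc2]
    ring
  have hbcx : 2 * (b * (c + x)) = (a+b+c) * (b+c-a) := by linear_combination hc2 - ha2
  have hcx : 0 < c + x := by nlinarith
  have hs : 0 < a+b+c := by positivity
  have hbca : 0 < b + c - a := by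
    have : 0 < (a+b+c) * (b+c-a) := by rw [← hbcx]; positivity
    exact (pos_iff_pos_of_mul_pos this).mp hs
  have hpow : o1^2 + o2^2 - R^2 = j * b := by
    linear_combination hCo + b * ho1
  have h1 : j*b - k * (ix * (2*o1) + iy * 2 * (o2 + R)) + k^2 * ix^2 = 0 := by
    linear_combination hD - hpow
  have h2 : b * (j*(a+b+c)^2 - k * (a+b+c) * ((c+j)*(c+b) + u*a) + k^2 * b * (c+x)^2) = 0 := by
    have : j*b*(a+b+c)^2 - k * (a+b+c) * (((a+b+c)*ix) * (2*o1) + ((a+b+c)*iy) * 2 * (o2 + R)) + k^2 * ((a+b+c)*ix)^2 = 0 := by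
      linear_combination (a+b+c)^2 * h1
    rw [hix, hiy] at this
    linear_combination this + k*(a+b+c)*b*(c+x)*ho1 + k*(a+b+c)*b*ho2 + k*(a+b+c)*b*hRu
  have h3 := (mul_eq_zero.mp h2).resolve_left hb.ne'
  have h4 : (a+b+c) * ((k*(c+x) - (c+j-u)) * ((b+c-a) * (k*(c+x)) - (a+b+c)*(c+j+u))) = 0 := by
    linear_combination 2*(c+x) * h3 - (k*(c+x))^2 * hbcx + (a+b+c)^2*(hu2 - hc2)
  have h5 := (mul_eq_zero.mp h4).resolve_left hs.ne'
  rcases mul_eq_zero.mp h5 with h | h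
  · linarith
  · exfalso
    have hxu : x - j < u := lt_of_pow_lt_pow_left₀ 2 hu (by linarith [pow_pos hy 2])
    have h6 : (b+c-a)*k < a+b+c := by linarith [mul_pos ha hk]
    have h7 := mul_lt_mul_of_pos_right h6 hcx
    have h8 : (a+b+c) * (c+x) < (a+b+c) * (c+j+u) := by
      apply mul_lt_mul_of_pos_left _ hs
      linarith
    linarith

set_option maxHeartbeats 1000000 in
/-- In the Ajima-circle configuration, let `J` be a point where `ω` meets the open
segment `AC`, let `F` be the point of line `AC` with `IF ∥ BJ`, and let `E` be the
touch point of `γ` with `AC`.  Then `IF = FE`. -/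
theorem IF_eq_FE
    (A B C I Oω D T : Plane) (r Rω ρ : ℝ)
    (hABC : AffineIndependent ℝ ![A, B, C])
    (hr : 0 < r)
    (hIin : I ∈ interior (convexHull ℝ ({A, B, C} : Set Plane)))
    (hIab : Metric.infDist I (affineSpan ℝ ({A, B} : Set Plane) : Set Plane) = r)
    (hIbc : Metric.infDist I (affineSpan ℝ ({B, C} : Set Plane) : Set Plane) = r)
    (hIca : Metric.infDist I (affineSpan ℝ ({C, A} : Set Plane) : Set Plane) = r)
    (hRω : 0 < Rω) (hρ : 0 < ρ)
    (hBω : dist B Oω = Rω) (hCω : dist C Oω = Rω)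
    (hγin : Metric.sphere D ρ ⊆ convexHull ℝ ({A, B, C} : Set Plane))
    (hγAB : Metric.infDist D (affineSpan ℝ ({A, B} : Set Plane) : Set Plane) = ρ)
    (hγAC : Metric.infDist D (affineSpan ℝ ({A, C} : Set Plane) : Set Plane) = ρ)
    (hext : dist Oω D = Rω + ρ)
    (hTω : dist T Oω = Rω) (hTγ : dist T D = ρ)
    (hTseg : Wbtw ℝ Oω T D)
    (hTin : T ∈ interior (convexHull ℝ ({A, B, C} : Set Plane)))
    (J F E : Plane)
    (hJseg : J ∈ openSegment ℝ A C) (hJω : dist J Oω = Rω)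
    (hF : F ∈ affineSpan ℝ ({A, C} : Set Plane))
    (hFpar : affineSpan ℝ ({I, F} : Set Plane) ∥ affineSpan ℝ ({B, J} : Set Plane))
    (hE : E ∈ affineSpan ℝ ({A, C} : Set Plane)) (hEγ : dist D E = ρ) :
    dist I F = dist F E := by
  have hinj := hABC.injective
  have hAB : A ≠ B := fun h => by simpa using hinj (a₁ := 0) (a₂ := 1) (by simpa using h)
  have hBC : B ≠ C := fun h => by simpa using hinj (a₁ := 1) (a₂ := 2) (by simpa using h)
  have hAC : A ≠ C := fun h => by simpa using hinj (a₁ := 0) (a₂ := 2) (by simpa using h)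
  have hDin : D ∈ convexHull ℝ ({A, B, C} : Set Plane) := by
    have h1 : D ∈ Metric.closedBall D ρ := Metric.mem_closedBall_self hρ.le
    rw [← convexHull_sphere_eq_closedBall D hρ.le] at h1
    exact convexHull_min hγin (convex_convexHull ℝ _) h1
  obtain ⟨β, γ, hβ, hγ, hβγ, hI⟩ := aj_hull (interior_subset hIin)
  obtain ⟨β', γ', hβ', hγ', hβγ', hD⟩ := aj_hull hDin
  have e1 := aj_infDist hAB hIab
  have e2 := aj_infDist hBC hIbc
  have e3 := aj_infDist hAC.symm hIca
  have e4 := aj_infDist hAB hγAB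
  have e5 := aj_infDist hAC hγAC
  rw [dist_comm C A] at e3
  have hc : 0 < dist A B := dist_pos.mpr hAB
  have ha : 0 < dist B C := dist_pos.mpr hBC
  have hb : 0 < dist A C := dist_pos.mpr hAC
  have hc2 := aj_dist_sq A B
  have ha2 := aj_dist_sq B C
  have hb2 := aj_dist_sq A C
  set a := dist B C with hadef
  set b := dist A C with hbdef
  set c := dist A B with hcdef
  obtain ⟨S, hS⟩ : ∃ S, S = (B 0 - A 0) * (C 1 - A 1) - (B 1 - A 1) * (C 0 - A 0) := ⟨_, rfl⟩
  have e1' : r * c = γ * |S| := by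
    rw [e1, ← abs_of_nonneg hγ, ← abs_mul, hI 0, hI 1, hS]; congr 1; ring
  have e3' : r * b = β * |S| := by
    rw [e3, ← abs_of_nonneg hβ, ← abs_mul, hI 0, hI 1, hS]; congr 1; ring
  have e2' : r * a = (1 - β - γ) * |S| := by
    have h0 : 0 ≤ 1 - β - γ := by linarith
    rw [e2, ← abs_of_nonneg h0, ← abs_mul, hI 0, hI 1, hS]; congr 1; ring
  have e4' : ρ * c = γ' * |S| := by
    rw [e4, ← abs_of_nonneg hγ', ← abs_mul, hD 0, hD 1, hS]; congr 1; ring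
  have e5' : ρ * b = β' * |S| := by
    rw [e5, ← abs_of_nonneg hβ', ← abs_mul, ← abs_neg, hD 0, hD 1, hS]
    congr 1; ring
  have hN : 0 < |S| := by
    have h1 : 0 < γ * |S| := by rw [← e1']; positivity
    exact pos_of_mul_pos_right h1 hγ
  have hS0 : S ≠ 0 := abs_pos.mp hN
  have hrs : r * (a + b + c) = |S| := by linear_combination e1' + e2' + e3'
  have hsβ : (a+b+c) * β = b := by
    apply mul_left_cancel₀ hr.ne'; linear_combination β * hrs - e3'
  have hsγ : (a+b+c) * γ = c := by
    apply mul_left_cancel₀ hr.ne'; linear_combination γ * hrs - e1'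
  obtain ⟨k, hk⟩ : ∃ k, k = ρ / r := ⟨_, rfl⟩
  have hkpos : 0 < k := by rw [hk]; positivity
  have hkr : ρ = k * r := by rw [hk]; field_simp
  have hkβ : β' = k * β := by
    apply mul_right_cancel₀ hN.ne'; linear_combination -e5' + b * hkr + k * e3'
  have hkγ : γ' = k * γ := by
    apply mul_right_cancel₀ hN.ne'; linear_combination -e4' + c * hkr + k * e1'
  have hs : 0 < a + b + c := by positivity
  have hk2 : k * (b + c) ≤ a + b + c := by
    have : k * (b + c) = (a+b+c) * (β' + γ') := by
      rw [hkβ, hkγ]; linear_combination -k * hsβ - k * hsγ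
    rw [this]; exact mul_le_of_le_one_right hs.le hβγ'
  -- frame
  obtain ⟨σ, hσ⟩ : ∃ σ, σ = -|S| / S := ⟨_, rfl⟩
  have hσ2 : σ ^ 2 = 1 := by rw [hσ, div_pow, neg_sq, sq_abs]; field_simp
  have hσS : -σ * S = |S| := by rw [hσ]; field_simp; try ring
  obtain ⟨p, hp⟩ : ∃ p, p = (C 0 - A 0) / b := ⟨_, rfl⟩
  obtain ⟨q, hq⟩ : ∃ q, q = (C 1 - A 1) / b := ⟨_, rfl⟩
  have hpb : C 0 - A 0 = b * p := by rw [hp]; field_simp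
  have hqb : C 1 - A 1 = b * q := by rw [hq]; field_simp
  have hpq : p ^ 2 + q ^ 2 = 1 := by
    apply mul_left_cancel₀ (pow_ne_zero 2 hb.ne')
    have : (A 0 - C 0)^2 + (A 1 - C 1)^2 = b^2 * (p^2 + q^2) := by
      linear_combination (C 0 - A 0 + b * p) * hpb + (C 1 - A 1 + b * q) * hqb
    rw [← this, mul_one, hb2]
  obtain ⟨X, hX⟩ : ∃ X : Plane → ℝ, ∀ P, X P = p * (P 0 - A 0) + q * (P 1 - A 1) :=
    ⟨_, fun _ => rfl⟩
  obtain ⟨Y, hY⟩ : ∃ Y : Plane → ℝ, ∀ P, Y P = σ * (-q * (P 0 - A 0) + p * (P 1 - A 1)) :=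
    ⟨_, fun _ => rfl⟩
  have hdist : ∀ P Q : Plane, dist P Q ^ 2 = (X P - X Q)^2 + (Y P - Y Q)^2 := by
    intro P Q
    rw [aj_dist_sq, hX, hX, hY, hY]
    linear_combination (-((P 0 - Q 0)^2 + (P 1 - Q 1)^2)) * hpq
      - (q * (P 0 - Q 0) - p * (P 1 - Q 1))^2 * hσ2
  have hXA : X A = 0 := by rw [hX]; ring
  have hYA : Y A = 0 := by rw [hY]; ring
  have hXC : X C = b := by rw [hX, hpb, hqb]; linear_combination b * hpq
  have hYC : Y C = 0 := by rw [hY, hpb, hqb]; ring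
  have hYB : b * Y B = |S| := by
    rw [hY, ← hσS, hS, hpb, hqb]; ring
  have hyB : 0 < Y B := by
    have : 0 < b * Y B := by rw [hYB]; exact hN
    exact pos_of_mul_pos_right this hb.le
  have hXI : X I = β * X B + γ * b := by
    rw [← hXC, hX, hX, hX, hI 0, hI 1]; ring
  have hYI : Y I = β * Y B := by
    have : Y I = β * Y B + γ * Y C := by rw [hY, hY, hY, hI 0, hI 1]; ring
    rw [this, hYC]; ring
  have hXD : X D = k * X I := by
    have : X D = β' * X B + γ' * X C := by rw [hX, hX, hX, hD 0, hD 1]; ring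
    rw [this, hXC, hkβ, hkγ, hXI]; ring
  have hYD : Y D = k * Y I := by
    have : Y D = β' * Y B + γ' * Y C := by rw [hY, hY, hY, hD 0, hD 1]; ring
    rw [this, hYC, hkβ, hYI]; ring
  have hrY : r = Y I := by
    apply mul_right_cancel₀ hb.ne'
    rw [e3', hYI, ← hYB]; ring
  obtain ⟨w, τ, hw, hτ, hwτ, hJ⟩ := hJseg
  have hJi : ∀ i, J i = A i + τ * (C i - A i) := by
    intro i
    have : w = 1 - τ := by linarith
    rw [← hJ, this]; simp; ring
  have hXJ : X J = τ * b := by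
    rw [← hXC, hX, hX, hJi 0, hJi 1]; ring
  have hYJ : Y J = 0 := by
    have : Y J = τ * Y C := by rw [hY, hY, hJi 0, hJi 1]; ring
    rw [this, hYC, mul_zero]
  obtain ⟨f, hf⟩ := aj_line hF
  have hYF : Y F = 0 := by
    have : Y F = f * Y C := by rw [hY, hY, hf 0, hf 1]; ring
    rw [this, hYC, mul_zero]
  obtain ⟨ε, hε⟩ := aj_line hE
  have hYE : Y E = 0 := by
    have : Y E = ε * Y C := by rw [hY, hY, hε 0, hε 1]; ring
    rw [this, hYC, mul_zero]
  obtain ⟨l, hl⟩ : ∃ l : ℝ, ∀ i, I i - F i = l * (B i - J i) := by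
    rw [AffineSubspace.affineSpan_pair_parallel_iff_vectorSpan_eq] at hFpar
    have h1 := vsub_mem_vectorSpan_pair ℝ I F
    rw [hFpar, mem_vectorSpan_pair] at h1
    obtain ⟨l, hl⟩ := h1
    refine ⟨l, fun i => ?_⟩
    have := congrArg (fun v : Plane => v i) hl
    simpa using this.symm
  have hlY : Y I - Y F = l * (Y B - Y J) := by
    rw [hY, hY, hY, hY]
    linear_combination σ * (-q) * hl 0 + σ * p * hl 1
  have hlX : X I - X F = l * (X B - X J) := by
    rw [hX, hX, hX, hX]
    linear_combination p * hl 0 + q * hl 1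
  have hlβ : l = β := by
    apply mul_right_cancel₀ hyB.ne'
    rw [hYF, hYJ, hYI] at hlY; linarith
  subst hlβ
  have hXE : X E = k * X I := by
    have h1 := hdist D E
    rw [hEγ, hYE, hYD, ← hrY, ← hkr, hXD] at h1
    have h2 : (k * X I - X E)^2 = 0 := by linarith
    have h3 := pow_eq_zero_iff (two_ne_zero) |>.mp h2
    linarith
  have hτ1 : τ * b < b := mul_lt_of_lt_one_left hb (by linarith)
  have dc := hdist B A
  have da := hdist B C
  have du := hdist B J
  have dB := hdist B Oω
  have dC := hdist C Oω
  have dJ := hdist J Oω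
  have dD := hdist Oω D
  rw [dist_comm, ← hcdef, hXA, hYA] at dc
  rw [← hadef, hXC, hYC] at da
  rw [hXJ, hYJ] at du
  rw [hBω] at dB
  rw [hCω, hXC, hYC] at dC
  rw [hJω, hXJ, hYJ] at dJ
  rw [hext, hXD, hYD, hkr] at dD
  have hsX : (a+b+c) * X I = b * (c + X B) := by
    rw [hXI]; linear_combination X B * hsβ + b * hsγ
  have key := aj_core a b c (X B) (Y B) (τ * b) (X Oω) (Y Oω) Rω (X I) (Y I) k (dist B J)
    ha hb hc hyB hRω dist_nonneg (by positivity) hτ1 hkpos hk2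
    (by linear_combination -dc) (by linear_combination -da) (by linear_combination -du)
    dB.symm (by linear_combination -dC) (by linear_combination -dJ) hsX
    (by rw [hYI]; linear_combination Y B * hsβ)
    (by rw [← dD, hrY])
  apply (sq_eq_sq₀ dist_nonneg dist_nonneg).mp
  rw [hdist I F, hdist F E, hlX, hlY, hYF, hYE, hXJ, hYJ]
  have hfin : X F - X E = l * dist B J := by
    apply mul_left_cancel₀ hs.ne'
    rw [hXE]
    rw [hXJ] at hlX
    linear_combination -(a+b+c) * hlX + (1 - k) * hsX - (X B - τ * b) * hsβ - b * key - dist B J * hsβ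
  rw [hfin]
  linear_combination -l^2 * du
end

section
/- Line DT* is perpendicular to line BC. -/
open EuclideanGeometry Real RealInnerProductSpace Affine

/-- the key quadratic, in tangent-length parameters -/
lemma core_e (x y z r v R y0 : ℝ) (hx : 0 < x) (hy : 0 < y) (hz : 0 < z) (hr : 0 < r)
    (hrs : r^2*(x+y+z) = x*y*z)
    (hρ : 0 < r - v*r*(y+z)) (hd : 0 ≤ r + v*r*(2*x+y+z))
    (hR : 0 < R) (hO : ((y+z)/2)^2 + y0^2 = R^2)
    (hext : ((y+z)/2 - (y + v*x*(y-z)))^2 + (y0 - (r + v*r*(2*x+y+z)))^2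
      = (R + (r - v*r*(y+z)))^2) :
    2*v*x*(R-y0) = r := by
  have he : 0 < R - y0 := by nlinarith [mul_pos (add_pos hy hz) (add_pos hy hz)]
  have hfac : (2*v*x*(R-y0) - r) * (2*r*(y+z+x)*(R-y0) + (y+z)^2*x*(1+v*x)) = 0 := by
    linear_combination 2*x*(R-y0)*(hext-hO) - 2*x*(2*r*(1+v*x))*hO
      - (2+8*x*v*(1+v*x))*(R-y0)*hrs
  rcases mul_eq_zero.1 hfac with h | h
  · linarith
  · exfalso
    have h1 : 0 < 1 + v*x := by
      have : 0 < 2*r*(1+v*x) := by linarith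
      exact pos_of_mul_pos_right this (by positivity)
    have : 0 < 2*r*(y+z+x)*(R-y0) + (y+z)^2*x*(1+v*x) := by positivity
    linarith

/-- end of argument -/
lemma core_end (o y0 R dx dy ρ tx ty k ix iy m sx sy a : ℝ) (ha : 0 < a)
    (hR : 0 < R) (hρ : 0 < ρ) (hy0 : y0 < R)
    (hext : (o-dx)^2 + (y0-dy)^2 = (R+ρ)^2)
    (hk : k*(R+ρ) = R) (htx : tx = o + k*(dx-o)) (hty : ty = y0 + k*(dy-y0))
    (hty0 : 0 ≤ ty)
    (hsx : sx = ix + m*(tx-ix)) (hsy : sy = iy + m*(ty-iy))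
    (hs : (sx-dx)^2 + (sy-dy)^2 = ρ^2) (hne : ¬ (sx = tx ∧ sy = ty))
    (hR2 : -R < y0) (hcol : (ix-o)*(dy-y0+R+ρ) = (iy-y0+R)*(dx-o)) : sx = dx := by
  have hk0 : 0 < k := by
    by_contra hh
    nlinarith
  have hk1 : 0 < 1 - k := by
    by_contra hh
    nlinarith
  obtain ⟨w, hw⟩ : ∃ w, w = dy-y0+R+ρ := ⟨_, rfl⟩
  obtain ⟨q, hq⟩ : ∃ q, q = dx-o := ⟨_, rfl⟩
  have hT : ty = y0 - R + k*w := by rw [hty, hw]; linear_combination -hk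
  have hwpos : 0 < w := by
    by_contra hh
    nlinarith
  obtain ⟨κ, hκ⟩ : ∃ κ, iy - ty = κ*w := ⟨(iy-ty)/w, by field_simp⟩
  have hκ2 : ix - tx = κ*q := by
    have : w*(ix - tx) = w*(κ*q) := by
      rw [← hw, ← hq] at hcol
      rw [htx, ← hq]
      linear_combination hcol + q*hκ + q*hT
    exact mul_left_cancel₀ hwpos.ne' this
  obtain ⟨μ, hμ⟩ : ∃ μ, μ = (1-m)*κ := ⟨_, rfl⟩
  have h1 : sx = tx + μ*q := by rw [hsx, hμ]; linear_combination (1-m)*hκ2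
  have h2 : sy = ty + μ*w := by rw [hsy, hμ]; linear_combination (1-m)*hκ
  have hμ0 : μ ≠ 0 := by
    rintro h; apply hne; rw [h1, h2, h]; simp
  have hn : 0 < q^2 + w^2 := by positivity
  have e1 : sx - dx = (μ-(1-k))*q := by rw [h1, htx, hq]; ring
  have e2 : sy - dy = ρ + (μ-(1-k))*w := by rw [h2, hT, hw]; ring
  have h3 : (μ-(1-k))*((μ-(1-k))*(q^2+w^2) + 2*ρ*w) = 0 := by
    rw [e1, e2] at hs; linear_combination hs
  have h4 : (1-k)*(q^2+w^2) = 2*ρ*w := by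
    have : (R+ρ)*((1-k)*(q^2+w^2)) = (R+ρ)*(2*ρ*w) := by
      rw [hq, hw]
      linear_combination ρ*hext - ((dx-o)^2+(dy-y0+R+ρ)^2)*hk
    exact mul_left_cancel₀ (by positivity) this
  rcases mul_eq_zero.1 h3 with h | h
  · rw [h] at e1; linarith
  · exfalso
    have : μ*(q^2+w^2) = 0 := by linear_combination h + h4
    rcases mul_eq_zero.1 this with h | h
    · exact hμ0 h
    · exact hn.ne' h

lemma tri_ineq (a p h b c : ℝ) (ha : 0 < a) (hh : 0 < h) (hb0 : 0 < b) (hc0 : 0 < c)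
    (hb : b^2 = (p-a)^2+h^2) (hc : c^2 = p^2+h^2) :
    0 < b + c - a ∧ 0 < a + c - b ∧ 0 < a + b - c := by
  have hh2 : 0 < h^2 := by positivity
  obtain ⟨p1, p2⟩ := abs_lt_of_sq_lt_sq' (show p^2 < c^2 by linarith) hc0.le
  obtain ⟨p3, p4⟩ := abs_lt_of_sq_lt_sq' (show (p-a)^2 < b^2 by linarith) hb0.le
  refine ⟨by linarith, ?_, ?_⟩
  · have := mul_pos ha (show 0 < c + p by linarith)
    have := lt_of_pow_lt_pow_left₀ 2 (show 0 ≤ a + c by positivity) (show b^2 < (a+c)^2 by linarith)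
    linarith
  · have := mul_pos ha (show 0 < b - (p-a) by linarith)
    have := lt_of_pow_lt_pow_left₀ 2 (show 0 ≤ a + b by positivity) (show c^2 < (a+b)^2 by linarith)
    linarith

lemma core (a p h r R ρ o y0 dx dy tx ty k ix iy m sx sy α β γ α' β' γ' : ℝ)
    (ha : 0 < a) (hh : 0 < h) (hr : 0 < r) (hR : 0 < R) (hρ : 0 < ρ)
    (hα : 0 ≤ α) (hβ : 0 ≤ β) (hγ : 0 ≤ γ) (h1 : α+β+γ=1)
    (hα' : 0 ≤ α') (hβ' : 0 ≤ β') (hγ' : 0 ≤ γ') (h1' : α'+β'+γ'=1)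
    (hix : ix = α*p+γ*a) (hiy : iy = α*h)
    (hdx : dx = α'*p+γ'*a) (hdy : dy = α'*h)
    (hbc : (iy*a)^2 = r^2*a^2) (hab : (ix*h-iy*p)^2 = r^2*(p^2+h^2))
    (hac : ((ix-a)*h-iy*(p-a))^2 = r^2*((p-a)^2+h^2))
    (hab' : (dx*h-dy*p)^2 = ρ^2*(p^2+h^2))
    (hac' : ((dx-a)*h-dy*(p-a))^2 = ρ^2*((p-a)^2+h^2))
    (hB : o^2+y0^2=R^2) (hC : (o-a)^2+y0^2=R^2)
    (hext : (o-dx)^2 + (y0-dy)^2 = (R+ρ)^2)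
    (hk : 0 ≤ k) (htx : tx = o + k*(dx-o)) (hty : ty = y0 + k*(dy-y0))
    (hto : (tx-o)^2+(ty-y0)^2=R^2)
    (hty0 : 0 ≤ ty)
    (hsx : sx = ix + m*(tx-ix)) (hsy : sy = iy + m*(ty-iy))
    (hs : (sx-dx)^2 + (sy-dy)^2 = ρ^2) (hne : ¬ (sx = tx ∧ sy = ty)) : sx = dx := by
  have ho : o = a/2 := by
    have : a*(2*o-a) = 0 := by linear_combination hB - hC
    rcases mul_eq_zero.1 this with h | h
    · exact absurd h ha.ne'
    · linarith
  have hkR : k*(R+ρ) = R := by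
    have : (k*(R+ρ))^2 = R^2 := by
      rw [← hto, htx, hty]; linear_combination -k^2*hext
    exact (sq_eq_sq₀ (by positivity) hR.le).1 this
  obtain ⟨c, hc0, hc⟩ : ∃ c, 0 < c ∧ c^2 = p^2+h^2 :=
    ⟨√(p^2+h^2), by positivity, Real.sq_sqrt (by positivity)⟩
  obtain ⟨b, hb0, hb⟩ : ∃ b, 0 < b ∧ b^2 = (p-a)^2+h^2 :=
    ⟨√((p-a)^2+h^2), by positivity, Real.sq_sqrt (by positivity)⟩
  have g1 : iy = r := by
    have : (iy*a) = r*a := (sq_eq_sq₀ (by rw [hiy]; positivity) (by positivity)).1 (by rw [hbc]; ring)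
    exact mul_right_cancel₀ ha.ne' this
  have g2 : γ*a*h = r*c := (sq_eq_sq₀ (by positivity) (by positivity)).1 (by
    rw [mul_pow r, hc, ← hab, hix, hiy]; ring)
  have g3 : β*a*h = r*b := (sq_eq_sq₀ (by positivity) (by positivity)).1 (by
    rw [mul_pow r, hb, ← hac, hix, hiy]
    have : β = 1 - α - γ := by linarith
    rw [this]; ring)
  have g2' : γ'*a*h = ρ*c := (sq_eq_sq₀ (by positivity) (by positivity)).1 (by
    rw [mul_pow ρ, hc, ← hab', hdx, hdy]; ring)
  have g3' : β'*a*h = ρ*b := (sq_eq_sq₀ (by positivity) (by positivity)).1 (by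
    rw [mul_pow ρ, hb, ← hac', hdx, hdy]
    have : β' = 1 - α' - γ' := by linarith
    rw [this]; ring)
  obtain ⟨t1, t2, t3⟩ := tri_ineq a p h b c ha hh hb0 hc0 hb hc
  obtain ⟨x, hx⟩ : ∃ x, x = (b+c-a)/2 := ⟨_, rfl⟩
  obtain ⟨y, hy⟩ : ∃ y, y = (a+c-b)/2 := ⟨_, rfl⟩
  obtain ⟨z, hz⟩ : ∃ z, z = (a+b-c)/2 := ⟨_, rfl⟩
  have ha' : a = y+z := by linarith
  have hb' : b = x+z := by linarith
  have hc' : c = x+y := by linarith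
  have x0 : 0 < x := by linarith
  have y0' : 0 < y := by linarith
  have z0 : 0 < z := by linarith
  have hah : a*h = 2*r*(x+y+z) := by
    have : a*h = r*(a+b+c) := by linear_combination -a*h*h1 + g2 + g3 - a*hiy + a*g1
    rw [this, ha', hb', hc']; ring
  have hap : a*p = a*y + x*(y-z) := by
    have : 2*(a*p) = a^2 + c^2 - b^2 := by linear_combination hb - hc
    rw [hb', hc'] at this
    rw [ha'] at this ⊢
    linarith
  have hrs : r^2*(x+y+z) = x*y*z := by
    have : (x+y+z)*(4*(r^2*(x+y+z))) = (x+y+z)*(4*(x*y*z)) := by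
      have e : (a*h)^2 + (a*p)^2 = a^2*c^2 := by rw [hc]; ring
      rw [hah, hap, hc', ha'] at e
      linear_combination e
    have := mul_left_cancel₀ (by positivity) this
    linarith
  obtain ⟨v, hv⟩ : ∃ v, ρ = r - v*r*(y+z) := ⟨(r-ρ)/(r*(y+z)), by field_simp; ring⟩
  have hdy' : dy = r + v*r*(2*x+y+z) := by
    rw [hdy]
    have : a*(α'*h) = a*(r + v*r*(2*x+y+z)) := by
      have : a*(α'*h) = a*h - ρ*(b+c) := by linear_combination a*h*h1' - g2' - g3'
      rw [this, hah, hv, hb', hc', ha']; ring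
    exact mul_left_cancel₀ ha.ne' this
  have hix' : ix = y := by
    have : (a*h)*ix = (a*h)*y := by
      rw [hix]
      linear_combination a*p*(g1-hiy) + a*g2 + r*hap + a*r*hc' - y*hah + (r*x+2*r*y)*ha'
    exact mul_left_cancel₀ (by positivity) this
  have hdx' : dx = y + v*x*(y-z) := by
    have : (a*h)*dx = (a*h)*(y + v*x*(y-z)) := by
      rw [hdx]
      have e1 : a*h*(α'*p+γ'*a) = (a*p)*(α'*h) + a*(γ'*a*h) := by ring
      rw [e1, g2', ← hdy, hdy', hap, hah, hc', hv, ha']; ring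
    exact mul_left_cancel₀ (by positivity) this
  have ho2 : 0 < o^2 := by rw [ho]; positivity
  obtain ⟨hyR2, hyR⟩ := abs_lt_of_sq_lt_sq' (show y0^2 < R^2 by linarith) hR.le
  have he : 2*v*x*(R-y0) = r := by
    apply core_e x y z r v R y0 x0 y0' z0 hr hrs (hv ▸ hρ) (by rw [← hdy', hdy]; positivity) hR
    · rw [← ha', ← ho]; exact hB
    · rw [← ha', ← hdx', ← hdy', ← ho, ha', ← hv]; exact hext
  refine core_end o y0 R dx dy ρ tx ty k ix iy m sx sy a ha hR hρ hyR hext hkR htx hty hty0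
    hsx hsy hs hne hyR2 ?_
  rw [hix', g1, hdy', hv, hdx', ho, ha']
  linear_combination (z-y)/2*he

lemma dist_sq_coord (X Y : Plane) : dist X Y ^ 2 = (X 0 - Y 0)^2 + (X 1 - Y 1)^2 := by
  rw [EuclideanSpace.dist_eq, Real.sq_sqrt (by positivity)]
  simp [Fin.sum_univ_two, Real.dist_eq, sq_abs]

lemma line_coord (X P Q : Plane) (h : X ∈ affineSpan ℝ ({P, Q} : Set Plane)) :
    ∃ s : ℝ, X 0 = P 0 + s*(Q 0 - P 0) ∧ X 1 = P 1 + s*(Q 1 - P 1) := by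
  obtain ⟨s, rfl⟩ := mem_affineSpan_pair_iff_exists_lineMap_eq.1 h
  refine ⟨s, ?_, ?_⟩ <;> simp [AffineMap.lineMap_apply] <;> ring

lemma infDist_coord (X P Q : Plane) (d : ℝ)
    (h : Metric.infDist X (affineSpan ℝ ({P, Q} : Set Plane) : Set Plane) = d) :
    ((X 0 - P 0)*(Q 1 - P 1) - (X 1 - P 1)*(Q 0 - P 0))^2
      = d^2*((Q 0 - P 0)^2 + (Q 1 - P 1)^2) := by
  haveI : Nonempty (affineSpan ℝ ({P, Q} : Set Plane)) := ⟨⟨P, left_mem_affineSpan_pair ℝ P Q⟩⟩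
  obtain ⟨F, hF⟩ : ∃ F : Plane, F = EuclideanGeometry.orthogonalProjection
    (affineSpan ℝ ({P, Q} : Set Plane)) X := ⟨_, rfl⟩
  have hmem : F ∈ affineSpan ℝ ({P, Q} : Set Plane) := by
    rw [hF]; exact EuclideanGeometry.orthogonalProjection_mem X
  have hd : dist X F = d := by
    rw [hF, EuclideanGeometry.dist_orthogonalProjection_eq_infDist, h]
  have ho : ⟪Q - P, X - F⟫ = (0:ℝ) := by
    have h1 := EuclideanGeometry.vsub_orthogonalProjection_mem_direction_orthogonal
      (affineSpan ℝ ({P, Q} : Set Plane)) X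
    rw [Submodule.mem_orthogonal] at h1
    have h2 := h1 (Q -ᵥ P) (AffineSubspace.vsub_mem_direction
      (right_mem_affineSpan_pair ℝ P Q) (left_mem_affineSpan_pair ℝ P Q))
    rw [hF]
    simpa using h2
  have hd2 := dist_sq_coord X F
  rw [hd] at hd2
  simp [PiLp.inner_apply, Fin.sum_univ_two] at ho
  obtain ⟨s, h0, h1⟩ := line_coord F P Q hmem
  have e : (X 0 - P 0)*(Q 1 - P 1) - (X 1 - P 1)*(Q 0 - P 0)
    = (X 0 - F 0)*(Q 1 - P 1) - (X 1 - F 1)*(Q 0 - P 0) := by rw [h0, h1]; ring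
  rw [e, hd2]
  linear_combination (-((X 0 - F 0)*(Q 0 - P 0) + (X 1 - F 1)*(Q 1 - P 1)))*ho

lemma hull_coord (X A B C : Plane) (h : X ∈ convexHull ℝ ({A, B, C} : Set Plane)) :
    ∃ α β γ : ℝ, 0 ≤ α ∧ 0 ≤ β ∧ 0 ≤ γ ∧ α + β + γ = 1 ∧
      X 0 = α * A 0 + β * B 0 + γ * C 0 ∧ X 1 = α * A 1 + β * B 1 + γ * C 1 := by
  rw [convexHull_insert (by simp), convexHull_pair, mem_convexJoin] at h
  obtain ⟨a, ha, b, ⟨s, t, hs, ht, hst, rfl⟩, ⟨s', t', hs', ht', hst', rfl⟩⟩ := h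
  rw [Set.mem_singleton_iff] at ha
  subst ha
  refine ⟨s', t'*s, t'*t, hs', by positivity, by positivity, ?_, ?_, ?_⟩
  · linear_combination hst' + t'*hst
  · simp; ring
  · simp; ring

lemma center_mem (D : Plane) (ρ : ℝ) (hρ : 0 < ρ) (K : Set Plane) (hK : Convex ℝ K)
    (h : Metric.sphere D ρ ⊆ K) : D ∈ K := by
  obtain ⟨v, hv⟩ : ∃ v : Plane, ‖v‖ = ρ := ⟨EuclideanSpace.single 0 ρ, by simp [abs_of_pos hρ]⟩
  have h1 : D + v ∈ K := h (by simp [hv])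
  have h2 : D - v ∈ K := h (by simp [hv])
  have := hK h1 h2 (show (0:ℝ) ≤ 1/2 by norm_num) (show (0:ℝ) ≤ 1/2 by norm_num) (by norm_num)
  convert this using 1
  module

lemma cross_ne (A B C : Plane) (hABC : AffineIndependent ℝ ![A, B, C]) :
    (A 1 - B 1)*(C 0 - B 0) - (A 0 - B 0)*(C 1 - B 1) ≠ 0 := by
  intro h0
  rw [affineIndependent_iff_not_collinear_set] at hABC
  apply hABC
  by_cases hBC : C = B
  · subst hBC
    simpa using collinear_pair ℝ A C
  have hn : (C 0 - B 0)^2 + (C 1 - B 1)^2 ≠ 0 := by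
    rw [← dist_sq_coord]
    exact pow_ne_zero _ (dist_ne_zero.2 hBC)
  rw [collinear_iff_of_mem (p₀ := B) (by simp)]
  refine ⟨C - B, ?_⟩
  intro p hp
  simp only [Set.mem_insert_iff, Set.mem_singleton_iff] at hp
  rcases hp with rfl | rfl | rfl
  · refine ⟨((p 0 - B 0)*(C 0 - B 0) + (p 1 - B 1)*(C 1 - B 1))/((C 0 - B 0)^2 + (C 1 - B 1)^2), ?_⟩
    ext i
    fin_cases i
    · simp
      field_simp
      linear_combination (C 1 - B 1) * (-h0)
    · simp
      field_simp
      linear_combination (C 0 - B 0) * h0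
  · exact ⟨0, by simp⟩
  · exact ⟨1, by simp⟩

lemma sq_sum_zero (s t : ℝ) (h : s^2+t^2 ≤ 0) : s = 0 ∧ t = 0 := by
  have h1 : s^2 = 0 := by linarith [sq_nonneg s, sq_nonneg t]
  have h2 : t^2 = 0 := by linarith [sq_nonneg s, sq_nonneg t]
  exact ⟨pow_eq_zero_iff (by norm_num) |>.1 h1, pow_eq_zero_iff (by norm_num) |>.1 h2⟩

set_option maxHeartbeats 1000000 in
lemma coords (A0 A1 B0 B1 C0 C1 I0 I1 D0 D1 T0 T1 O0 O1 S0 S1 r R ρ α β γ α' β' γ' α2 β2 γ2 m k : ℝ)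
    (hcr : (A1 - B1)*(C0 - B0) - (A0 - B0)*(C1 - B1) ≠ 0)
    (hr : 0 < r) (hR : 0 < R) (hρ : 0 < ρ)
    (hα : 0 ≤ α) (hβ : 0 ≤ β) (hγ : 0 ≤ γ) (h1 : α+β+γ=1)
    (hI0 : I0 = α*A0+β*B0+γ*C0) (hI1 : I1 = α*A1+β*B1+γ*C1)
    (hα' : 0 ≤ α') (hβ' : 0 ≤ β') (hγ' : 0 ≤ γ') (h1' : α'+β'+γ'=1)
    (hD0 : D0 = α'*A0+β'*B0+γ'*C0) (hD1 : D1 = α'*A1+β'*B1+γ'*C1)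
    (hα2 : 0 ≤ α2) (h12 : α2+β2+γ2=1)
    (hT0 : T0 = α2*A0+β2*B0+γ2*C0) (hT1 : T1 = α2*A1+β2*B1+γ2*C1)
    (hm0 : S0 = I0 + m*(T0-I0)) (hm1 : S1 = I1 + m*(T1-I1))
    (hk0 : 0 ≤ k) (hk_0 : T0 = O0 + k*(D0-O0)) (hk_1 : T1 = O1 + k*(D1-O1))
    (qab : ((I0-A0)*(B1-A1)-(I1-A1)*(B0-A0))^2 = r^2*((B0-A0)^2+(B1-A1)^2))
    (qbc : ((I0-B0)*(C1-B1)-(I1-B1)*(C0-B0))^2 = r^2*((C0-B0)^2+(C1-B1)^2))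
    (qca : ((I0-C0)*(A1-C1)-(I1-C1)*(A0-C0))^2 = r^2*((A0-C0)^2+(A1-C1)^2))
    (qab' : ((D0-A0)*(B1-A1)-(D1-A1)*(B0-A0))^2 = ρ^2*((B0-A0)^2+(B1-A1)^2))
    (qac' : ((D0-A0)*(C1-A1)-(D1-A1)*(C0-A0))^2 = ρ^2*((C0-A0)^2+(C1-A1)^2))
    (dB : R^2 = (B0-O0)^2+(B1-O1)^2) (dC : R^2 = (C0-O0)^2+(C1-O1)^2)
    (dE : (R+ρ)^2 = (O0-D0)^2+(O1-D1)^2) (dT : R^2 = (T0-O0)^2+(T1-O1)^2)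
    (dS : ρ^2 = (D0-S0)^2+(D1-S1)^2) (hne : ¬ (S0 = T0 ∧ S1 = T1)) :
    (S0-D0)*(C0-B0)+(S1-D1)*(C1-B1) = 0 := by
  have hn : 0 < (C0-B0)^2+(C1-B1)^2 := by
    by_contra hh
    obtain ⟨e0, e1⟩ := sq_sum_zero _ _ (not_lt.1 hh)
    apply hcr; rw [e0, e1]; ring
  obtain ⟨a, ha, ha2⟩ : ∃ a, 0 < a ∧ a^2 = (C0-B0)^2+(C1-B1)^2 :=
    ⟨√((C0-B0)^2+(C1-B1)^2), by positivity, Real.sq_sqrt hn.le⟩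
  obtain ⟨e, he⟩ : ∃ e, C0 = B0 + a*e := ⟨(C0-B0)/a, by field_simp; ring⟩
  obtain ⟨f, hf⟩ : ∃ f, C1 = B1 + a*f := ⟨(C1-B1)/a, by field_simp; ring⟩
  have hu : e^2+f^2 = 1 := by
    have : a^2*(e^2+f^2) = a^2*1 := by rw [he, hf] at ha2; linear_combination -ha2
    exact mul_left_cancel₀ (by positivity) this
  clear ha2 hn
  subst he hf
  obtain ⟨σ, hσ, hh⟩ : ∃ σ : ℝ, σ^2 = 1 ∧ 0 < σ*((A1-B1)*e-(A0-B0)*f) := by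
    have : (A1-B1)*e-(A0-B0)*f ≠ 0 := by
      intro h; apply hcr; linear_combination a*h
    rcases lt_or_gt_of_ne this with h | h
    · exact ⟨-1, by norm_num, by linarith⟩
    · exact ⟨1, by norm_num, by linarith⟩
  -- length and cross-product invariance
  have key : ∀ s t : ℝ, (s*e+t*f)^2 + (σ*(t*e-s*f))^2 = s^2+t^2 := by
    intro s t
    linear_combination (t*e-s*f)^2*hσ + (s^2+t^2)*hu
  have key2 : ∀ s t s' t' : ℝ, ((s*e+t*f)*(σ*(t'*e-s'*f)) - (σ*(t*e-s*f))*(s'*e+t'*f))^2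
      = (s*t'-t*s')^2 := by
    intro s t s' t'
    have : (s*e+t*f)*(σ*(t'*e-s'*f)) - (σ*(t*e-s*f))*(s'*e+t'*f) = σ*(s*t'-t*s') := by
      linear_combination σ*(s*t'-t*s')*hu
    rw [this, mul_pow, hσ, one_mul]
  have hβe : β = 1-α-γ := by linarith
  have hβe' : β' = 1-α'-γ' := by linarith
  have hβe2 : β2 = 1-α2-γ2 := by linarith
  have fin := core a ((A0-B0)*e+(A1-B1)*f) (σ*((A1-B1)*e-(A0-B0)*f)) r R ρ
    ((O0-B0)*e+(O1-B1)*f) (σ*((O1-B1)*e-(O0-B0)*f))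
    ((D0-B0)*e+(D1-B1)*f) (σ*((D1-B1)*e-(D0-B0)*f))
    ((T0-B0)*e+(T1-B1)*f) (σ*((T1-B1)*e-(T0-B0)*f)) k
    ((I0-B0)*e+(I1-B1)*f) (σ*((I1-B1)*e-(I0-B0)*f)) m
    ((S0-B0)*e+(S1-B1)*f) (σ*((S1-B1)*e-(S0-B0)*f)) α β γ α' β' γ'
    ha hh hr hR hρ hα hβ hγ h1 hα' hβ' hγ' h1'
    (by rw [hI0, hI1, hβe]; linear_combination γ*a*hu)
    (by rw [hI0, hI1, hβe]; ring)
    (by rw [hD0, hD1, hβe']; linear_combination γ'*a*hu)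
    (by rw [hD0, hD1, hβe']; ring)
    (by linear_combination qbc + a^2*((I1-B1)*e-(I0-B0)*f)^2*hσ + r^2*a^2*hu)
    (by rw [key2, key]; linear_combination qab)
    (by
      have k1 := key2 (I0-B0-a*e) (I1-B1-a*f) (A0-B0-a*e) (A1-B1-a*f)
      have k2 := key (A0-B0-a*e) (A1-B1-a*f)
      have z1 : ∀ s t : ℝ, (s-a*e)*e+(t-a*f)*f = s*e+t*f-a := by
        intro s t; linear_combination -a*hu
      have z2 : ∀ s t : ℝ, (t-a*f)*e-(s-a*e)*f = t*e-s*f := by intro s t; ring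
      rw [z1, z1, z2, z2] at k1
      rw [z1, z2] at k2
      rw [k1, k2]; linear_combination qca)
    (by rw [key2, key]; linear_combination qab')
    (by
      have k1 := key2 (D0-B0-a*e) (D1-B1-a*f) (A0-B0-a*e) (A1-B1-a*f)
      have k2 := key (A0-B0-a*e) (A1-B1-a*f)
      have z1 : ∀ s t : ℝ, (s-a*e)*e+(t-a*f)*f = s*e+t*f-a := by
        intro s t; linear_combination -a*hu
      have z2 : ∀ s t : ℝ, (t-a*f)*e-(s-a*e)*f = t*e-s*f := by intro s t; ring
      rw [z1, z1, z2, z2] at k1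
      rw [z1, z2] at k2
      rw [k1, k2]; linear_combination qac')
    (by rw [key]; linear_combination -dB)
    (by
      have k2 := key (O0-B0-a*e) (O1-B1-a*f)
      linear_combination k2 - dC + (2*a*((O0-B0)*e+(O1-B1)*f) - a^2*(e^2+f^2) - a^2)*hu)
    (by linear_combination key (O0-D0) (O1-D1) - dE)
    hk0
    (by rw [hk_0, hk_1]; ring)
    (by rw [hk_0, hk_1]; ring)
    (by linear_combination key (T0-O0) (T1-O1) - dT)
    (by
      have : σ*((T1-B1)*e-(T0-B0)*f) = α2*(σ*((A1-B1)*e-(A0-B0)*f)) := by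
        rw [hT0, hT1, hβe2]; ring
      rw [this]; exact mul_nonneg hα2 hh.le)
    (by rw [hm0, hm1]; ring)
    (by rw [hm0, hm1]; ring)
    (by linear_combination key (S0-D0) (S1-D1) - dS)
    (by
      rintro ⟨w1, w2⟩
      apply hne
      have := key (S0-T0) (S1-T1)
      have q1 : (S0-T0)*e+(S1-T1)*f = 0 := by linear_combination w1
      have q2 : σ*((S1-T1)*e-(S0-T0)*f) = 0 := by linear_combination w2
      rw [q1, q2] at this
      obtain ⟨e0, e1⟩ := sq_sum_zero (S0-T0) (S1-T1) (by rw [← this]; norm_num)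
      exact ⟨by linarith, by linarith⟩)
  linear_combination a*fin

/-- In the Ajima-circle configuration, let `T'` be the second intersection point of
line `IT` with `γ`.  Then `DT'` is perpendicular to `BC`. -/
theorem DT'_perp_BC
    (A B C I Oω D T : Plane) (r Rω ρ : ℝ)
    (hABC : AffineIndependent ℝ ![A, B, C])
    (hr : 0 < r)
    (hIin : I ∈ interior (convexHull ℝ ({A, B, C} : Set Plane)))
    (hIab : Metric.infDist I (affineSpan ℝ ({A, B} : Set Plane) : Set Plane) = r)
    (hIbc : Metric.infDist I (affineSpan ℝ ({B, C} : Set Plane) : Set Plane) = r)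
    (hIca : Metric.infDist I (affineSpan ℝ ({C, A} : Set Plane) : Set Plane) = r)
    (hRω : 0 < Rω) (hρ : 0 < ρ)
    (hBω : dist B Oω = Rω) (hCω : dist C Oω = Rω)
    (hγin : Metric.sphere D ρ ⊆ convexHull ℝ ({A, B, C} : Set Plane))
    (hγAB : Metric.infDist D (affineSpan ℝ ({A, B} : Set Plane) : Set Plane) = ρ)
    (hγAC : Metric.infDist D (affineSpan ℝ ({A, C} : Set Plane) : Set Plane) = ρ)
    (hext : dist Oω D = Rω + ρ)
    (hTω : dist T Oω = Rω) (hTγ : dist T D = ρ)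
    (hTseg : Wbtw ℝ Oω T D)
    (hTin : T ∈ interior (convexHull ℝ ({A, B, C} : Set Plane)))
    (T' : Plane)
    (hT' : T' ∈ affineSpan ℝ ({I, T} : Set Plane))
    (hT'γ : dist D T' = ρ) (hT'ne : T' ≠ T) :
    ⟪T' - D, C - B⟫ = (0:ℝ) := by
  have hcr := cross_ne A B C hABC
  obtain ⟨α, β, γ, hα, hβ, hγ, h1, hI0, hI1⟩ := hull_coord I A B C (interior_subset hIin)
  obtain ⟨α', β', γ', hα', hβ', hγ', h1', hD0, hD1⟩ := hull_coord D A B C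
    (center_mem D ρ hρ _ (convex_convexHull ℝ _) hγin)
  obtain ⟨α2, β2, γ2, hα2, hβ2, hγ2, h12, hT0, hT1⟩ := hull_coord T A B C (interior_subset hTin)
  obtain ⟨m, hm0, hm1⟩ := line_coord T' I T hT'
  obtain ⟨k, ⟨hk0, hk1⟩, hkT⟩ := hTseg
  have hk_0 : T 0 = Oω 0 + k*(D 0 - Oω 0) := by
    rw [← hkT]; simp [AffineMap.lineMap_apply]; ring
  have hk_1 : T 1 = Oω 1 + k*(D 1 - Oω 1) := by
    rw [← hkT]; simp [AffineMap.lineMap_apply]; ring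
  have qab := infDist_coord _ _ _ _ hIab
  have qbc := infDist_coord _ _ _ _ hIbc
  have qca := infDist_coord _ _ _ _ hIca
  have qab' := infDist_coord _ _ _ _ hγAB
  have qac' := infDist_coord _ _ _ _ hγAC
  have dB := dist_sq_coord B Oω
  have dC := dist_sq_coord C Oω
  have dE := dist_sq_coord Oω D
  have dT := dist_sq_coord T Oω
  have dS := dist_sq_coord D T'
  rw [hBω] at dB
  rw [hCω] at dC
  rw [hext] at dE
  rw [hTω] at dT
  rw [hT'γ] at dS
  have hne : ¬ (T' 0 = T 0 ∧ T' 1 = T 1) := by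
    rintro ⟨e0, e1⟩
    apply hT'ne
    ext i
    fin_cases i
    · exact e0
    · exact e1
  have hgoal : ⟪T' - D, C - B⟫ = (T' 0 - D 0)*(C 0 - B 0) + (T' 1 - D 1)*(C 1 - B 1) := by
    simp [PiLp.inner_apply, Fin.sum_univ_two]; ring
  rw [hgoal]
  clear hgoal hABC hIin hIab hIbc hIca hBω hCω hγin hγAB hγAC hext hTω hTγ hTin hT' hT'γ hT'ne hkT
  generalize A 0 = A0, A 1 = A1, B 0 = B0, B 1 = B1, C 0 = C0, C 1 = C1, I 0 = I0, I 1 = I1,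
    D 0 = D0, D 1 = D1, T 0 = T0, T 1 = T1, Oω 0 = O0, Oω 1 = O1, T' 0 = S0, T' 1 = S1 at *
  exact coords A0 A1 B0 B1 C0 C1 I0 I1 D0 D1 T0 T1 O0 O1 S0 S1 r Rω ρ α β γ α' β' γ' α2 β2 γ2 m k
    hcr hr hRω hρ hα hβ hγ h1 hI0 hI1 hα' hβ' hγ' h1' hD0 hD1 hα2 h12 hT0 hT1 hm0 hm1 hk0
    hk_0 hk_1 qab qbc qca qab' qac' dB dC dE dT dS hne
end

section
/- Then TL = TT'; that is, dist(T,L) = dist(T,T'). -/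
open EuclideanGeometry Real RealInnerProductSpace Affine

set_option maxHeartbeats 1000000 in
theorem core1 (m n p r t w μ x y a : ℝ) (hm : 0 < m) (hn : 0 < n) (hp : 0 < p) (hr : 0 < r)
    (ht0 : 0 < t) (ht1 : t ≤ 1) (hμ0 : 0 < μ) (hμ1 : μ < 1) (ha : a = m + n)
    (hw : w = p * (1 - t))
    (hrr : r ^ 2 * (a + p) = m * n * p)
    (hB : (x + m) ^ 2 + y ^ 2 = μ * (m + w) ^ 2)
    (hC : (x - n) ^ 2 + y ^ 2 = μ * (n + w) ^ 2)
    (hD : (x - (m - n) * w / a) ^ 2 + (y - r * (a * (2 - t) + 2 * w) / a) ^ 2 = (r * t) ^ 2) :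
    x ^ 2 + y ^ 2 = 2 * y * r * (1 - t) + w ^ 2 := by
  have ha0 : 0 < a := by rw [ha]; positivity
  have hw0 : 0 ≤ w := by rw [hw]; exact mul_nonneg hp.le (by linarith)
  obtain ⟨Y, hY⟩ : ∃ Y, Y = r * (a * (2 - t) + 2 * w) / a := ⟨_, rfl⟩
  have hY0 : 0 < Y := by
    rw [hY]; apply div_pos _ ha0; apply mul_pos hr
    have : 0 < a * (2 - t) := mul_pos ha0 (by linarith)
    linarith
  have hY2 : Y ^ 2 - (r * t) ^ 2 = 4 * m * n * w * (a + w) / a ^ 2 := by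
    rw [hY, hw]; field_simp
    linear_combination (4 * (1 - t) * (a + p * (1 - t))) * hrr
  have hY3 : (a + p) * Y ^ 2 = m * n * p * t ^ 2 + (a + p) * (4 * m * n * w * (a + w) / a ^ 2) := by
    linear_combination (a + p) * hY2 + t ^ 2 * hrr
  rw [← hY] at hD
  have hx : 2 * x = (m - n) * (μ * (a + 2 * w) / a - 1) := by
    field_simp
    rw [ha]
    linear_combination hB - hC
  have hN : x ^ 2 + y ^ 2 = μ * (m * n + w ^ 2 + 4 * m * n * w / a) - m * n := by
    field_simp
    rw [ha]
    linear_combination n * hB + m * hC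
  have hy : 2 * y * Y = μ * (m * n * (1 + 8 * (w * (a + w)) / a ^ 2) - w * (a + w))
      + w * (a + w) - m * n := by
    have e : 2 * y * Y = (x ^ 2 + y ^ 2) - (2 * x) * ((m - n) * w / a) + ((m - n) * w / a) ^ 2
        + (Y ^ 2 - (r * t) ^ 2) := by linear_combination -hD
    rw [e, hx, hN, hY2]
    field_simp
    rw [ha]; ring
  have hQ : (μ * (m * n + w ^ 2 + (1 - t) * w * a + 4 * m * n * w * t / a)
        - (m * n + w ^ 2 + (1 - t) * w * a)) *
      (μ * ((m * n + w ^ 2) * (a + p) + (a + w + t * w) * p * a - 4 * m * n * t * (a + w) * p / a)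
        - ((m * n + w ^ 2) * (a + p) + (a + w + t * w) * p * a)) = 0 := by
    have e : (a + p) * Y ^ 2 * (2 * x) ^ 2 + (a + p) * (2 * y * Y) ^ 2
      - 4 * ((a + p) * Y ^ 2) * (x ^ 2 + y ^ 2) = 0 := by ring
    rw [hY3, hx, hy, hN] at e
    rw [← e, hw]
    field_simp
    rw [ha]
    ring
  have hF2 : (μ * ((m * n + w ^ 2) * (a + p) + (a + w + t * w) * p * a - 4 * m * n * t * (a + w) * p / a)
        - ((m * n + w ^ 2) * (a + p) + (a + w + t * w) * p * a)) < 0 := by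
    have h1 : 0 < 4 * m * n * t * (a + w) * p / a := by positivity
    have h2 : 0 < (m * n + w ^ 2) * (a + p) + (a + w + t * w) * p * a := by positivity
    have h3 := mul_pos hμ0 h1
    have h4 := mul_pos (sub_pos.2 hμ1) h2
    linarith
  have hF1 := (mul_eq_zero.1 hQ).resolve_right hF2.ne
  have : (x ^ 2 + y ^ 2 - (2 * y * r * (1 - t) + w ^ 2)) * Y = 0 := by
    have e : (x ^ 2 + y ^ 2 - (2 * y * r * (1 - t) + w ^ 2)) * Y = (x ^ 2 + y ^ 2 - w ^ 2) * Y
      - (2 * y * Y) * r * (1 - t) := by ring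
    rw [e, hN, hy, hY]
    field_simp
    field_simp at hF1
    linear_combination r * (a + 2 * w) * hF1
  have := (mul_eq_zero.1 this).resolve_right hY0.ne'
  linarith

set_option maxHeartbeats 1000000 in
theorem core2 (m n r t s x y xA yA α β γ : ℝ) (ha : 0 < m + n) (hr : 0 < r)
    (hα : 0 < α) (hβ : 0 < β) (hγ : 0 < γ) (hsum : α + β + γ = 1)
    (hx0 : α * xA - β * m + γ * n = 0) (hy0 : α * yA = r)
    (hAB : (r * (xA + m) - m * yA) ^ 2 = r ^ 2 * ((xA + m) ^ 2 + yA ^ 2))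
    (hAC : (r * (n - xA) - n * yA) ^ 2 = r ^ 2 * ((n - xA) ^ 2 + yA ^ 2))
    (ht0 : 0 < t) (ht1 : t ≤ 1) (hs0 : 0 < s) (hs1 : s < 1)
    (hB : (x + m) ^ 2 + y ^ 2 = s * ((xA * (1 - t) + m) ^ 2 + (yA + t * (r - yA)) ^ 2 - (r * t) ^ 2))
    (hC : (x - n) ^ 2 + y ^ 2 = s * ((xA * (1 - t) - n) ^ 2 + (yA + t * (r - yA)) ^ 2 - (r * t) ^ 2))
    (hD : (x - xA * (1 - t)) ^ 2 + (y - (yA + t * (r - yA))) ^ 2 = (r * t) ^ 2) :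
    t ^ 2 * (x ^ 2 + y ^ 2) = (1 - t) ^ 2 * ((x - xA) ^ 2 + (y - yA) ^ 2) := by
  have hyA : 0 < yA := by
    by_contra h
    have := mul_nonneg hα.le (neg_nonneg.2 (not_lt.1 h))
    linarith
  have h1 : (m ^ 2 - r ^ 2) * yA = 2 * r * m * (xA + m) := by
    apply mul_left_cancel₀ hyA.ne'
    linear_combination hAB
  have h2 : (n ^ 2 - r ^ 2) * yA = 2 * r * n * (n - xA) := by
    apply mul_left_cancel₀ hyA.ne'
    linear_combination hAC
  have h3 : 2 * m * γ * (m + n) = m ^ 2 + r ^ 2 := by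
    apply mul_left_cancel₀ hr.ne'
    have hb : β = 1 - α - γ := by linarith
    subst hb
    linear_combination α * h1 - (m ^ 2 - r ^ 2) * hy0 + 2 * r * m * hx0
  have h4 : 2 * n * β * (m + n) = n ^ 2 + r ^ 2 := by
    apply mul_left_cancel₀ hr.ne'
    have hb : γ = 1 - α - β := by linarith
    subst hb
    linear_combination α * h2 - (n ^ 2 - r ^ 2) * hy0 - 2 * r * n * hx0
  have hm : 0 < m := by
    by_contra h
    have h5 := mul_nonneg (neg_nonneg.2 (not_lt.1 h)) (mul_pos hγ ha).le
    have h6 : 0 < m ^ 2 + r ^ 2 := by positivity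
    linarith
  have hn : 0 < n := by
    by_contra h
    have h5 := mul_nonneg (neg_nonneg.2 (not_lt.1 h)) (mul_pos hβ ha).le
    have h6 : 0 < n ^ 2 + r ^ 2 := by positivity
    linarith
  have h5 : 2 * α * (m * n) = m * n - r ^ 2 := by
    apply mul_left_cancel₀ ha.ne'
    have hb : α = 1 - β - γ := by linarith
    subst hb
    linear_combination (-n) * h3 - m * h4
  have h6 : 0 < m * n - r ^ 2 := by rw [← h5]; positivity
  obtain ⟨p, hp⟩ : ∃ p, p = r ^ 2 * (m + n) / (m * n - r ^ 2) := ⟨_, rfl⟩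
  have hp0 : 0 < p := by rw [hp]; positivity
  have hrr : r ^ 2 * ((m + n) + p) = m * n * p := by
    have : p * (m * n - r ^ 2) = r ^ 2 * (m + n) := by rw [hp]; field_simp
    linear_combination -this
  have hyA' : yA * (m * n - r ^ 2) = 2 * r * (m * n) := by
    rw [← h5]; linear_combination 2 * (m * n) * hy0
  have hyA2 : yA = 2 * r * (m + n + p) / (m + n) := by
    rw [eq_div_iff ha.ne']
    apply mul_left_cancel₀ h6.ne'
    linear_combination (m + n) * hyA' + 2 * r * hrr
  have hxA2 : xA = (m - n) * p / (m + n) := by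
    rw [hyA2] at h1
    field_simp at h1
    rw [eq_div_iff ha.ne']
    apply mul_left_cancel₀ hm.ne'
    linear_combination (-1) * h1 - hrr
  have e1 : xA * (1 - t) = (m - n) * (p * (1 - t)) / (m + n) := by rw [hxA2]; ring
  have e2 : yA + t * (r - yA) = r * ((m + n) * (2 - t) + 2 * (p * (1 - t))) / (m + n) := by
    rw [hyA2]; field_simp; ring
  have e3 : (r * ((m + n) * (2 - t) + 2 * (p * (1 - t))) / (m + n)) ^ 2 - (r * t) ^ 2
      = 4 * m * n * (p * (1 - t)) * ((m + n) + p * (1 - t)) / (m + n) ^ 2 := by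
    field_simp
    linear_combination (4 * (1 - t) * ((m + n) + p * (1 - t))) * hrr
  have key := core1 m n p r t (p * (1 - t)) s x y (m + n) hm hn hp0 hr ht0 ht1 hs0 hs1 rfl rfl hrr
    (by
      rw [hB, e1, e2, add_sub_assoc, e3]; field_simp; ring)
    (by
      rw [hC, e1, e2, add_sub_assoc, e3]; field_simp; ring)
    (by rw [← e1, ← e2]; exact hD)
  have hAI : xA ^ 2 + (yA - r) ^ 2 = p ^ 2 + r ^ 2 := by
    rw [hxA2, hyA2]
    field_simp
    linear_combination 4 * p * hrr
  have hD2 : (1 - t) * ((x - xA) ^ 2 + (y - yA) ^ 2)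
      = -t * (x ^ 2 + y ^ 2) + 2 * t * y * r + t * (1 - t) * p ^ 2 := by
    linear_combination hD + t * (1 - t) * hAI
  linear_combination t * key - (1 - t) * hD2

theorem raw (a0 a1 b0 b1 c0 c1 i0 i1 d0 d1 t0 t1 l0 l1 r t lam s α β γ : ℝ)
    (hr : 0 < r) (hBC : 0 < (c0 - b0) ^ 2 + (c1 - b1) ^ 2)
    (hα : 0 < α) (hβ : 0 < β) (hγ : 0 < γ) (hsum : α + β + γ = 1)
    (hI0 : i0 = α * a0 + β * b0 + γ * c0) (hI1 : i1 = α * a1 + β * b1 + γ * c1)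
    (hL0 : l0 = b0 + lam * (c0 - b0)) (hL1 : l1 = b1 + lam * (c1 - b1))
    (hIL : (i0 - l0) ^ 2 + (i1 - l1) ^ 2 = r ^ 2)
    (hperp : (i0 - l0) * (c0 - b0) + (i1 - l1) * (c1 - b1) = 0)
    (hAB : ((b0 - a0) * (i1 - a1) - (b1 - a1) * (i0 - a0)) ^ 2
      = r ^ 2 * ((b0 - a0) ^ 2 + (b1 - a1) ^ 2))
    (hAC : ((a0 - c0) * (i1 - c1) - (a1 - c1) * (i0 - c0)) ^ 2
      = r ^ 2 * ((a0 - c0) ^ 2 + (a1 - c1) ^ 2))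
    (hD0 : d0 = a0 + t * (i0 - a0)) (hD1 : d1 = a1 + t * (i1 - a1))
    (ht0 : 0 < t) (ht1 : t ≤ 1) (hs0 : 0 < s) (hs1 : s < 1)
    (hB : (t0 - b0) ^ 2 + (t1 - b1) ^ 2 = s * ((d0 - b0) ^ 2 + (d1 - b1) ^ 2 - (r * t) ^ 2))
    (hC : (t0 - c0) ^ 2 + (t1 - c1) ^ 2 = s * ((d0 - c0) ^ 2 + (d1 - c1) ^ 2 - (r * t) ^ 2))
    (hD : (t0 - d0) ^ 2 + (t1 - d1) ^ 2 = (r * t) ^ 2) :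
    t ^ 2 * ((t0 - l0) ^ 2 + (t1 - l1) ^ 2) = (1 - t) ^ 2 * ((t0 - a0) ^ 2 + (t1 - a1) ^ 2) := by
  obtain ⟨a, ha0, ha⟩ : ∃ a : ℝ, 0 < a ∧ a ^ 2 = (c0 - b0) ^ 2 + (c1 - b1) ^ 2 :=
    ⟨_, Real.sqrt_pos.2 hBC, Real.sq_sqrt hBC.le⟩
  obtain ⟨u0, hu0⟩ : ∃ u0, c0 - b0 = a * u0 := ⟨(c0 - b0) / a, by field_simp⟩
  obtain ⟨u1, hu1⟩ : ∃ u1, c1 - b1 = a * u1 := ⟨(c1 - b1) / a, by field_simp⟩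
  obtain ⟨v0, hv0⟩ : ∃ v0, i0 - l0 = r * v0 := ⟨(i0 - l0) / r, by field_simp⟩
  obtain ⟨v1, hv1⟩ : ∃ v1, i1 - l1 = r * v1 := ⟨(i1 - l1) / r, by field_simp⟩
  have huu : u0 ^ 2 + u1 ^ 2 = 1 := by
    rw [hu0, hu1] at ha
    apply mul_left_cancel₀ (pow_pos ha0 2).ne'
    linear_combination -ha
  have hvv : v0 ^ 2 + v1 ^ 2 = 1 := by
    rw [hv0, hv1] at hIL
    apply mul_left_cancel₀ (pow_pos hr 2).ne'
    linear_combination hIL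
  have huv : u0 * v0 + u1 * v1 = 0 := by
    rw [hu0, hu1, hv0, hv1] at hperp
    apply mul_left_cancel₀ (mul_pos ha0 hr).ne'
    linear_combination hperp
  obtain ⟨ε, hε⟩ : ∃ ε, ε = u0 * v1 - u1 * v0 := ⟨_, rfl⟩
  have hε2 : ε ^ 2 = 1 := by
    rw [hε]
    linear_combination (v0 ^ 2 + v1 ^ 2) * huu + hvv - (u0 * v0 + u1 * v1) * huv
  have hw0 : v0 = -ε * u1 := by rw [hε]; linear_combination (-v0) * huu + u0 * huv
  have hw1 : v1 = ε * u0 := by rw [hε]; linear_combination (-v1) * huu + u1 * huv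
  have hn : ∀ p q : ℝ, p ^ 2 + q ^ 2 = (p * u0 + q * u1) ^ 2 + (p * v0 + q * v1) ^ 2 := by
    intro p q
    rw [hw0, hw1]
    linear_combination (-(p ^ 2 + q ^ 2)) * huu - (p * u1 - q * u0) ^ 2 * hε2
  have hcr : ∀ p q p' q' : ℝ, (p * q' - q * p') ^ 2
      = ((p * u0 + q * u1) * (p' * v0 + q' * v1) - (p * v0 + q * v1) * (p' * u0 + q' * u1)) ^ 2 := by
    intro p q p' q'
    have : ((p * u0 + q * u1) * (p' * v0 + q' * v1) - (p * v0 + q * v1) * (p' * u0 + q' * u1))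
      = ε * (p * q' - q * p') := by rw [hε]; ring
    rw [this, mul_pow, hε2, one_mul]
  -- coordinates
  obtain ⟨m, hm⟩ : ∃ m, m = lam * a := ⟨_, rfl⟩
  obtain ⟨n, hn'⟩ : ∃ n, n = (1 - lam) * a := ⟨_, rfl⟩
  have eb0 : b0 = l0 - m * u0 := by rw [hm]; linear_combination -hL0 - lam * hu0
  have eb1 : b1 = l1 - m * u1 := by rw [hm]; linear_combination -hL1 - lam * hu1
  have ec0 : c0 = l0 + n * u0 := by rw [hn']; linear_combination -hL0 + (1 - lam) * hu0
  have ec1 : c1 = l1 + n * u1 := by rw [hn']; linear_combination -hL1 + (1 - lam) * hu1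
  have ei0 : i0 = l0 + r * v0 := by linarith
  have ei1 : i1 = l1 + r * v1 := by linarith
  obtain ⟨xA, hxA⟩ : ∃ z, z = (a0 - l0) * u0 + (a1 - l1) * u1 := ⟨_, rfl⟩
  obtain ⟨yA, hyA⟩ : ∃ z, z = (a0 - l0) * v0 + (a1 - l1) * v1 := ⟨_, rfl⟩
  obtain ⟨x, hx⟩ : ∃ z, z = (t0 - l0) * u0 + (t1 - l1) * u1 := ⟨_, rfl⟩
  obtain ⟨y, hy⟩ : ∃ z, z = (t0 - l0) * v0 + (t1 - l1) * v1 := ⟨_, rfl⟩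
  have hb : β = 1 - α - γ := by linarith
  have k1 : α * xA - β * m + γ * n = 0 := by
    have e0 : r * v0 = α * (a0 - l0) + (γ * n - β * m) * u0 := by
      rw [hb]; rw [ei0, ec0, eb0, hb] at hI0; linear_combination hI0
    have e1 : r * v1 = α * (a1 - l1) + (γ * n - β * m) * u1 := by
      rw [hb]; rw [ei1, ec1, eb1, hb] at hI1; linear_combination hI1
    rw [hxA]
    linear_combination (-u0) * e0 - u1 * e1 + r * huv - (γ * n - β * m) * huu
  have k2 : α * yA = r := by
    have e0 : r * v0 = α * (a0 - l0) + (γ * n - β * m) * u0 := by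
      rw [hb]; rw [ei0, ec0, eb0, hb] at hI0; linear_combination hI0
    have e1 : r * v1 = α * (a1 - l1) + (γ * n - β * m) * u1 := by
      rw [hb]; rw [ei1, ec1, eb1, hb] at hI1; linear_combination hI1
    rw [hyA]
    linear_combination (-v0) * e0 - v1 * e1 + r * hvv - (γ * n - β * m) * huv
  -- products
  have pu : ∀ z, z * u0 * u0 + z * u1 * u1 = z := fun z => by linear_combination z * huu
  have pBu : ∀ p q : ℝ, (p - b0) * u0 + (q - b1) * u1 = ((p - l0) * u0 + (q - l1) * u1) + m := by
    intro p q; rw [eb0, eb1]; linear_combination m * huu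
  have pBv : ∀ p q : ℝ, (p - b0) * v0 + (q - b1) * v1 = ((p - l0) * v0 + (q - l1) * v1) := by
    intro p q; rw [eb0, eb1]; linear_combination m * huv
  have pCu : ∀ p q : ℝ, (p - c0) * u0 + (q - c1) * u1 = ((p - l0) * u0 + (q - l1) * u1) - n := by
    intro p q; rw [ec0, ec1]; linear_combination (-n) * huu
  have pCv : ∀ p q : ℝ, (p - c0) * v0 + (q - c1) * v1 = ((p - l0) * v0 + (q - l1) * v1) := by
    intro p q; rw [ec0, ec1]; linear_combination (-n) * huv
  have pAu : ∀ p q : ℝ, (p - a0) * u0 + (q - a1) * u1 = ((p - l0) * u0 + (q - l1) * u1) - xA := by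
    intro p q; rw [hxA]; ring
  have pAv : ∀ p q : ℝ, (p - a0) * v0 + (q - a1) * v1 = ((p - l0) * v0 + (q - l1) * v1) - yA := by
    intro p q; rw [hyA]; ring
  have pDu : (d0 - l0) * u0 + (d1 - l1) * u1 = xA * (1 - t) := by
    rw [hD0, hD1, ei0, ei1, hxA]; linear_combination t * r * huv
  have pDv : (d0 - l0) * v0 + (d1 - l1) * v1 = yA + t * (r - yA) := by
    rw [hD0, hD1, ei0, ei1, hyA]; linear_combination t * r * hvv
  have pIu : (i0 - l0) * u0 + (i1 - l1) * u1 = 0 := by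
    rw [ei0, ei1]; linear_combination r * huv
  have pIv : (i0 - l0) * v0 + (i1 - l1) * v1 = r := by
    rw [ei0, ei1]; linear_combination r * hvv
  have pbu : (b0 - l0) * u0 + (b1 - l1) * u1 = -m := by
    rw [eb0, eb1]; linear_combination (-m) * huu
  have pbv : (b0 - l0) * v0 + (b1 - l1) * v1 = 0 := by
    rw [eb0, eb1]; linear_combination (-m) * huv
  have pTDu : (t0 - d0) * u0 + (t1 - d1) * u1 = x - xA * (1 - t) := by
    rw [← pDu, hx]; ring
  have pTDv : (t0 - d0) * v0 + (t1 - d1) * v1 = y - (yA + t * (r - yA)) := by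
    rw [← pDv, hy]; ring
  rw [hcr, hn, pAu, pAv, pAu, pAv, pIu, pIv, pbu, pbv] at hAB
  rw [hcr, hn, pCu, pCv, pCu, pCv, pIu, pIv, ← hxA, ← hyA] at hAC
  rw [hn (t0 - b0), hn (d0 - b0), pBu, pBv, pBu, pBv, pDu, pDv, ← hx, ← hy] at hB
  rw [hn (t0 - c0), hn (d0 - c0), pCu, pCv, pCu, pCv, pDu, pDv, ← hx, ← hy] at hC
  rw [hn, pTDu, pTDv] at hD
  have key := core2 m n r t s x y xA yA α β γ (by rw [hm, hn']; linarith) hr hα hβ hγ hsum k1 k2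
    (by linear_combination hAB) (by linear_combination hAC) ht0 ht1 hs0 hs1 hB hC hD
  rw [hn (t0 - l0), hn (t0 - a0), pAu, pAv, ← hx, ← hy]
  exact key

theorem sumsq_zero (p q : ℝ) (h : p ^ 2 + q ^ 2 = 0) : p = 0 ∧ q = 0 := by
  constructor <;> nlinarith [sq_nonneg p, sq_nonneg q]

theorem dsq (X Y : Plane) : dist X Y ^ 2 = (X 0 - Y 0) ^ 2 + (X 1 - Y 1) ^ 2 := by
  rw [EuclideanSpace.dist_sq_eq, Fin.sum_univ_two, Real.dist_eq, Real.dist_eq, sq_abs, sq_abs]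

theorem mem_line (P Q X : Plane) (h : X ∈ affineSpan ℝ ({P, Q} : Set Plane)) :
    ∃ k : ℝ, X 0 = P 0 + k * (Q 0 - P 0) ∧ X 1 = P 1 + k * (Q 1 - P 1) := by
  obtain ⟨k, rfl⟩ := (mem_affineSpan_pair_iff_exists_lineMap_eq).1 h
  refine ⟨k, ?_, ?_⟩ <;> simp [AffineMap.lineMap_apply] <;> ring

theorem line_mem (P Q : Plane) (k : ℝ) :
    ∃ X : Plane, X ∈ affineSpan ℝ ({P, Q} : Set Plane) ∧
      X 0 = P 0 + k * (Q 0 - P 0) ∧ X 1 = P 1 + k * (Q 1 - P 1) := by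
  refine ⟨AffineMap.lineMap P Q k, AffineMap.lineMap_mem_affineSpan_pair _ _ _, ?_, ?_⟩ <;>
    simp [AffineMap.lineMap_apply] <;> ring

theorem infd (X P Q : Plane) (r : ℝ)
    (h : Metric.infDist X (affineSpan ℝ ({P, Q} : Set Plane) : Set Plane) = r) :
    ((Q 0 - P 0) * (X 1 - P 1) - (Q 1 - P 1) * (X 0 - P 0)) ^ 2
      = r ^ 2 * ((Q 0 - P 0) ^ 2 + (Q 1 - P 1) ^ 2) := by
  have hr : 0 ≤ r := h ▸ Metric.infDist_nonneg
  have hcl : IsClosed (affineSpan ℝ ({P, Q} : Set Plane) : Set Plane) :=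
    AffineSubspace.closed_of_finiteDimensional _
  obtain ⟨F, hF, hFd⟩ := hcl.exists_infDist_eq_dist ⟨P, left_mem_affineSpan_pair ℝ P Q⟩ X
  rw [h] at hFd
  obtain ⟨k, hk0, hk1⟩ := mem_line P Q F hF
  have h1 := dsq X F
  rw [← hFd, hk0, hk1] at h1
  by_cases h0 : (Q 0 - P 0) ^ 2 + (Q 1 - P 1) ^ 2 = 0
  · obtain ⟨e0, e1⟩ := sumsq_zero _ _ h0
    rw [e0, e1]; ring
  have hpos : 0 < (Q 0 - P 0) ^ 2 + (Q 1 - P 1) ^ 2 := lt_of_le_of_ne (by positivity) (Ne.symm h0)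
  obtain ⟨G, hG, hG0, hG1⟩ := line_mem P Q
    (((Q 0 - P 0) * (X 0 - P 0) + (Q 1 - P 1) * (X 1 - P 1)) / ((Q 0 - P 0) ^ 2 + (Q 1 - P 1) ^ 2))
  have hle : r ≤ dist X G := h ▸ Metric.infDist_le_dist_of_mem hG
  have h2 := dsq X G
  have h3 : r ^ 2 ≤ dist X G ^ 2 := by gcongr
  rw [h2, hG0, hG1] at h3
  apply le_antisymm
  · rw [h1]
    have : 0 ≤ ((Q 0 - P 0) * (X 0 - P 0) + (Q 1 - P 1) * (X 1 - P 1)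
      - k * ((Q 0 - P 0) ^ 2 + (Q 1 - P 1) ^ 2)) ^ 2 := sq_nonneg _
    linarith
  · refine (mul_le_mul_of_nonneg_right h3 hpos.le).trans (le_of_eq ?_)
    field_simp
    ring

theorem bary (A B C : Plane) (hABC : AffineIndependent ℝ ![A, B, C]) :
    ∃ f : Plane → Fin 3 → ℝ, (∀ X, f X 0 + f X 1 + f X 2 = 1 ∧
      (X 0 = f X 0 * A 0 + f X 1 * B 0 + f X 2 * C 0) ∧
      (X 1 = f X 0 * A 1 + f X 1 * B 1 + f X 2 * C 1)) ∧
      (∀ X ∈ convexHull ℝ ({A, B, C} : Set Plane), ∀ i, 0 ≤ f X i) ∧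
      (∀ X ∈ interior (convexHull ℝ ({A, B, C} : Set Plane)), ∀ i, 0 < f X i) := by
  have htop : affineSpan ℝ (Set.range ![A, B, C]) = ⊤ := by
    rw [hABC.affineSpan_eq_top_iff_card_eq_finrank_add_one]
    simp
  let b : AffineBasis (Fin 3) ℝ Plane := ⟨![A, B, C], hABC, htop⟩
  have hbr : Set.range b = ({A, B, C} : Set Plane) := by
    change Set.range ![A, B, C] = _
    ext X
    simp [eq_comm]
    tauto
  refine ⟨fun X i => b.coord i X, ?_, ?_, ?_⟩
  · intro X
    have h1 := b.sum_coord_apply_eq_one X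
    have h2 := b.linear_combination_coord_eq_self X
    rw [Fin.sum_univ_three] at h1 h2
    refine ⟨h1, ?_, ?_⟩
    · have := congrArg (fun Z : Plane => Z 0) h2
      exact this.symm
    · have := congrArg (fun Z : Plane => Z 1) h2
      exact this.symm
  · intro X hX
    rw [← hbr, b.convexHull_eq_nonneg_coord] at hX
    exact hX
  · intro X hX
    rw [← hbr, b.interior_convexHull] at hX
    exact hX

set_option maxHeartbeats 2000000 in
/-- In the Ajima-circle configuration, let `L` be the touch point of the incircle
with `BC`, and let `T'` be the intersection of line `AT` with the incircle farther
from `A`.  Then `TL = TT'`. -/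
theorem TL_eq_TT'
    (A B C I Oω D T : Plane) (r Rω ρ : ℝ)
    (hABC : AffineIndependent ℝ ![A, B, C])
    (hr : 0 < r)
    (hIin : I ∈ interior (convexHull ℝ ({A, B, C} : Set Plane)))
    (hIab : Metric.infDist I (affineSpan ℝ ({A, B} : Set Plane) : Set Plane) = r)
    (hIbc : Metric.infDist I (affineSpan ℝ ({B, C} : Set Plane) : Set Plane) = r)
    (hIca : Metric.infDist I (affineSpan ℝ ({C, A} : Set Plane) : Set Plane) = r)
    (hRω : 0 < Rω) (hρ : 0 < ρ)
    (hBω : dist B Oω = Rω) (hCω : dist C Oω = Rω)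
    (hγin : Metric.sphere D ρ ⊆ convexHull ℝ ({A, B, C} : Set Plane))
    (hγAB : Metric.infDist D (affineSpan ℝ ({A, B} : Set Plane) : Set Plane) = ρ)
    (hγAC : Metric.infDist D (affineSpan ℝ ({A, C} : Set Plane) : Set Plane) = ρ)
    (hext : dist Oω D = Rω + ρ)
    (hTω : dist T Oω = Rω) (hTγ : dist T D = ρ)
    (hTseg : Wbtw ℝ Oω T D)
    (hTin : T ∈ interior (convexHull ℝ ({A, B, C} : Set Plane)))
    (L T' : Plane)
    (hL : L ∈ affineSpan ℝ ({B, C} : Set Plane)) (hLI : dist I L = r)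
    (hT' : T' ∈ affineSpan ℝ ({A, T} : Set Plane)) (hT'I : dist I T' = r)
    (hT'far : ∀ P : Plane, P ∈ affineSpan ℝ ({A, T} : Set Plane) → dist I P = r →
      dist A P ≤ dist A T') :
    dist T L = dist T T' := by
  obtain ⟨f, hf, hfn, hfp⟩ := bary A B C hABC
  obtain ⟨hsum, hI0, hI1⟩ := hf I
  have hα := hfp I hIin 0
  have hβ := hfp I hIin 1
  have hγ := hfp I hIin 2
  generalize f I 0 = α at *
  generalize f I 1 = β at *
  generalize f I 2 = γ at *
  have cAB := infd _ _ _ _ hIab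
  have cBC := infd _ _ _ _ hIbc
  have cCA := infd _ _ _ _ hIca
  have dAB := infd _ _ _ _ hγAB
  have dAC := infd _ _ _ _ hγAC
  -- the signed area
  obtain ⟨S, hS⟩ : ∃ S, S = (B 0 - A 0) * (C 1 - A 1) - (B 1 - A 1) * (C 0 - A 0) := ⟨_, rfl⟩
  have hα' : α = 1 - β - γ := by linarith
  have cAB' : (γ * S) ^ 2 = r ^ 2 * ((B 0 - A 0) ^ 2 + (B 1 - A 1) ^ 2) := by
    rw [← cAB, hI0, hI1, hS, hα']; ring
  have cAC' : (β * S) ^ 2 = r ^ 2 * ((C 0 - A 0) ^ 2 + (C 1 - A 1) ^ 2) := by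
    have : r ^ 2 * ((C 0 - A 0) ^ 2 + (C 1 - A 1) ^ 2)
      = r ^ 2 * ((A 0 - C 0) ^ 2 + (A 1 - C 1) ^ 2) := by ring
    rw [this, ← cCA, hI0, hI1, hS, hα']; ring
  have hSne : S ≠ 0 := by
    intro h0
    rw [h0] at cAB'
    have hAB : A ≠ B := by
      intro h
      have := hABC.injective.ne (show (0 : Fin 3) ≠ 1 by decide)
      exact this (by simpa using h)
    have h1 : 0 < dist A B ^ 2 := pow_pos (dist_pos.2 hAB) 2
    rw [dsq] at h1
    have h2 := mul_pos (pow_pos hr 2) h1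
    linarith
  have hBC : 0 < (C 0 - B 0) ^ 2 + (C 1 - B 1) ^ 2 := by
    rcases lt_or_eq_of_le (show 0 ≤ (C 0 - B 0) ^ 2 + (C 1 - B 1) ^ 2 by positivity) with h | h
    · exact h
    · exfalso
      obtain ⟨e0, e1⟩ := sumsq_zero _ _ h.symm
      apply hSne
      rw [hS]; linear_combination (B 0 - A 0) * e1 - (B 1 - A 1) * e0
  -- the point D
  have hDin : D ∈ convexHull ℝ ({A, B, C} : Set Plane) := by
    obtain ⟨e, he⟩ : ∃ e : Plane, ‖e‖ = ρ := ⟨EuclideanSpace.single 0 ρ, by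
      simp [abs_of_pos hρ]⟩
    have h1 : D + e ∈ convexHull ℝ ({A, B, C} : Set Plane) := hγin (by simp [he])
    have h2 : D - e ∈ convexHull ℝ ({A, B, C} : Set Plane) := hγin (by simp [he])
    have h3 := (convex_convexHull ℝ ({A, B, C} : Set Plane)) h1 h2
      (show (0 : ℝ) ≤ 1 / 2 by norm_num) (show (0 : ℝ) ≤ 1 / 2 by norm_num) (by norm_num)
    convert h3 using 1
    module
  obtain ⟨hsumD, hD0', hD1'⟩ := hf D
  have hβD := hfn D hDin 1
  have hγD := hfn D hDin 2
  obtain ⟨t, ht⟩ : ∃ t, t = ρ / r := ⟨_, rfl⟩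
  have ht0 : 0 < t := by rw [ht]; positivity
  have hρt : ρ = r * t := by rw [ht]; field_simp
  have hαD : f D 0 = 1 - f D 1 - f D 2 := by linarith
  rw [hαD] at hD0' hD1'
  have g1 : f D 2 = t * γ := by
    have e : (f D 2 * S) ^ 2 = ρ ^ 2 * ((B 0 - A 0) ^ 2 + (B 1 - A 1) ^ 2) := by
      rw [← dAB, hD0', hD1', hS]; ring
    have e2 : (f D 2) ^ 2 = (t * γ) ^ 2 := by
      apply mul_right_cancel₀ (pow_ne_zero 2 hSne)
      rw [hρt] at e
      linear_combination e - t ^ 2 * cAB'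
    exact (sq_eq_sq₀ hγD (by positivity)).1 e2
  have g2 : f D 1 = t * β := by
    have e : (f D 1 * S) ^ 2 = ρ ^ 2 * ((C 0 - A 0) ^ 2 + (C 1 - A 1) ^ 2) := by
      rw [← dAC, hD0', hD1', hS]; ring
    have e2 : (f D 1) ^ 2 = (t * β) ^ 2 := by
      apply mul_right_cancel₀ (pow_ne_zero 2 hSne)
      rw [hρt] at e
      linear_combination e - t ^ 2 * cAC'
    exact (sq_eq_sq₀ hβD (by positivity)).1 e2
  have hD0 : D 0 = A 0 + t * (I 0 - A 0) := by
    rw [hD0', g1, g2, hI0, hα']; ring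
  have hD1 : D 1 = A 1 + t * (I 1 - A 1) := by
    rw [hD1', g1, g2, hI1, hα']; ring
  -- the point L
  obtain ⟨lam, hL0, hL1⟩ := mem_line _ _ _ hL
  have hIL := dsq I L
  rw [hLI] at hIL
  have hperp : (I 0 - L 0) * (C 0 - B 0) + (I 1 - L 1) * (C 1 - B 1) = 0 := by
    have e : ((I 0 - L 0) * (C 0 - B 0) + (I 1 - L 1) * (C 1 - B 1)) ^ 2 = 0 := by
      have e1 : (C 0 - B 0) * (I 1 - B 1) - (C 1 - B 1) * (I 0 - B 0)
        = (C 0 - B 0) * (I 1 - L 1) - (C 1 - B 1) * (I 0 - L 0) := by rw [hL0, hL1]; ring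
      rw [e1] at cBC
      linear_combination (-((C 0 - B 0) ^ 2 + (C 1 - B 1) ^ 2)) * hIL - cBC
    exact pow_eq_zero_iff (two_ne_zero) |>.1 e
  have perpB : (B 0 - L 0) * (I 0 - L 0) + (B 1 - L 1) * (I 1 - L 1) = 0 := by
    linear_combination (-lam) * hperp - (I 0 - L 0) * hL0 - (I 1 - L 1) * hL1
  have perpC : (C 0 - L 0) * (I 0 - L 0) + (C 1 - L 1) * (I 1 - L 1) = 0 := by
    linear_combination perpB + hperp
  have fA : α * ((A 0 - L 0) * (I 0 - L 0) + (A 1 - L 1) * (I 1 - L 1)) = r ^ 2 := by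
    linear_combination (-β) * perpB - γ * perpC - hIL - (I 0 - L 0) * hI0 - (I 1 - L 1) * hI1
      - (L 0 * (I 0 - L 0) + L 1 * (I 1 - L 1)) * hsum
  have fApos : 0 < (A 0 - L 0) * (I 0 - L 0) + (A 1 - L 1) * (I 1 - L 1) := by
    have : 0 < α * ((A 0 - L 0) * (I 0 - L 0) + (A 1 - L 1) * (I 1 - L 1)) := by
      rw [fA]; positivity
    exact pos_of_mul_pos_right this hα.le
  have ht1 : t ≤ 1 := by
    obtain ⟨X, hX0, hX1⟩ : ∃ X : Plane, X 0 = D 0 - t * (I 0 - L 0) ∧ X 1 = D 1 - t * (I 1 - L 1) :=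
      ⟨!₂[D 0 - t * (I 0 - L 0), D 1 - t * (I 1 - L 1)], by simp, by simp⟩
    have hX : X ∈ convexHull ℝ ({A, B, C} : Set Plane) := by
      apply hγin
      rw [Metric.mem_sphere]
      have h1 := dsq X D
      rw [hX0, hX1] at h1
      apply (sq_eq_sq₀ dist_nonneg hρ.le).1
      rw [h1, hρt]
      linear_combination (-t ^ 2) * hIL
    obtain ⟨hsX, hx0, hx1⟩ := hf X
    have hαX := hfn X hX 0
    have e : f X 0 * ((A 0 - L 0) * (I 0 - L 0) + (A 1 - L 1) * (I 1 - L 1))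
      = (1 - t) * ((A 0 - L 0) * (I 0 - L 0) + (A 1 - L 1) * (I 1 - L 1)) := by
      have e1 : (X 0 - L 0) * (I 0 - L 0) + (X 1 - L 1) * (I 1 - L 1)
        = (1 - t) * ((A 0 - L 0) * (I 0 - L 0) + (A 1 - L 1) * (I 1 - L 1)) := by
        rw [hX0, hX1, hD0, hD1]; ring
      have e2 : (X 0 - L 0) * (I 0 - L 0) + (X 1 - L 1) * (I 1 - L 1)
        = f X 0 * ((A 0 - L 0) * (I 0 - L 0) + (A 1 - L 1) * (I 1 - L 1)) := by
        linear_combination (f X 1) * perpB + (f X 2) * perpC + (I 0 - L 0) * hx0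
          + (I 1 - L 1) * hx1 + (L 0 * (I 0 - L 0) + L 1 * (I 1 - L 1)) * hsX
      rw [← e2, e1]
    have := mul_right_cancel₀ fApos.ne' e
    linarith
  -- the point T
  obtain ⟨s, ⟨hs0', hs1'⟩, hTs⟩ := hTseg
  have hT0 : T 0 = Oω 0 + s * (D 0 - Oω 0) := by
    rw [← hTs]; simp [AffineMap.lineMap_apply]; ring
  have hT1 : T 1 = Oω 1 + s * (D 1 - Oω 1) := by
    rw [← hTs]; simp [AffineMap.lineMap_apply]; ring
  have qTO := dsq T Oω
  have qOD := dsq Oω D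
  have qTD := dsq T D
  have qBO := dsq B Oω
  have qCO := dsq C Oω
  rw [hTω] at qTO
  rw [hext] at qOD
  rw [hTγ] at qTD
  rw [hBω] at qBO
  rw [hCω] at qCO
  have hsR : Rω = s * (Rω + ρ) := by
    apply (sq_eq_sq₀ hRω.le (by positivity)).1
    rw [hT0, hT1] at qTO
    linear_combination qTO - s ^ 2 * qOD
  have hs0 : 0 < s := by
    rcases lt_or_eq_of_le hs0' with h | h
    · exact h
    · rw [← h] at hsR; linarith
  have hs1 : s < 1 := by
    rcases lt_or_eq_of_le hs1' with h | h
    · exact h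
    · rw [h] at hsR; linarith
  have hTX : ∀ x0 x1 : ℝ, Rω ^ 2 = (x0 - Oω 0) ^ 2 + (x1 - Oω 1) ^ 2 →
      (T 0 - x0) ^ 2 + (T 1 - x1) ^ 2 = s * ((D 0 - x0) ^ 2 + (D 1 - x1) ^ 2 - (r * t) ^ 2) := by
    intro x0 x1 h
    rw [← hρt, hT0, hT1]
    linear_combination (-(1 - s)) * h + s * (1 - s) * qOD + (Rω - s * Rω - s * ρ) * hsR
  have hB := hTX _ _ qBO
  have hC := hTX _ _ qCO
  rw [hρt] at qTD
  have key := raw (A 0) (A 1) (B 0) (B 1) (C 0) (C 1) (I 0) (I 1) (D 0) (D 1) (T 0) (T 1) (L 0) (L 1)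
    r t lam s α β γ hr hBC hα hβ hγ hsum hI0 hI1 hL0 hL1 hIL.symm hperp cAB cCA hD0 hD1 ht0 ht1
    hs0 hs1 hB hC qTD.symm
  -- T is the far intersection with the circle centered at D
  obtain ⟨hsT, hT0', hT1'⟩ := hf T
  have wα := hfp T hTin 0
  have wβ := hfp T hTin 1
  have wγ := hfp T hTin 2
  have hfar : 0 < (T 0 - D 0) * (T 0 - A 0) + (T 1 - D 1) * (T 1 - A 1) := by
    have e1 : 0 < ((B 0 - T 0) ^ 2 + (B 1 - T 1) ^ 2) + ((C 0 - T 0) ^ 2 + (C 1 - T 1) ^ 2) := by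
      linarith [sq_nonneg ((B 0 - T 0) + (C 0 - T 0)), sq_nonneg ((B 1 - T 1) + (C 1 - T 1))]
    have e2 : 0 < f T 1 * ((B 0 - T 0) ^ 2 + (B 1 - T 1) ^ 2)
        + f T 2 * ((C 0 - T 0) ^ 2 + (C 1 - T 1) ^ 2) := by
      have n1 : 0 ≤ (B 0 - T 0) ^ 2 + (B 1 - T 1) ^ 2 := by positivity
      have n2 : 0 ≤ (C 0 - T 0) ^ 2 + (C 1 - T 1) ^ 2 := by positivity
      rcases lt_or_eq_of_le n1 with h | h
      · have := mul_pos wβ h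
        have := mul_nonneg wγ.le n2
        linarith
      · rw [← h] at e1 ⊢
        have := mul_pos wγ (show 0 < (C 0 - T 0) ^ 2 + (C 1 - T 1) ^ 2 by linarith)
        linarith
    have a0 : f T 0 * (T 0 - A 0) = f T 1 * (B 0 - T 0) + f T 2 * (C 0 - T 0) := by
      linear_combination T 0 * hsT + hT0'
    have a1 : f T 0 * (T 1 - A 1) = f T 1 * (B 1 - T 1) + f T 2 * (C 1 - T 1) := by
      linear_combination T 1 * hsT + hT1'
    have b0 : s * (T 0 - D 0) = (1 - s) * (Oω 0 - T 0) := by rw [hT0]; ring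
    have b1 : s * (T 1 - D 1) = (1 - s) * (Oω 1 - T 1) := by rw [hT1]; ring
    have e3 : 2 * (f T 0 * s) * ((T 0 - D 0) * (T 0 - A 0) + (T 1 - D 1) * (T 1 - A 1))
      = (1 - s) * (f T 1 * ((B 0 - T 0) ^ 2 + (B 1 - T 1) ^ 2)
        + f T 2 * ((C 0 - T 0) ^ 2 + (C 1 - T 1) ^ 2)) := by
      have : 2 * (f T 0 * s) * ((T 0 - D 0) * (T 0 - A 0) + (T 1 - D 1) * (T 1 - A 1))
        = 2 * ((s * (T 0 - D 0)) * (f T 0 * (T 0 - A 0)) + (s * (T 1 - D 1)) * (f T 0 * (T 1 - A 1))) := by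
        ring
      rw [this, a0, a1, b0, b1]
      linear_combination (1 - s) * f T 1 * (qBO - qTO) + (1 - s) * f T 2 * (qCO - qTO)
    have e4 : 0 < 2 * (f T 0 * s) * ((T 0 - D 0) * (T 0 - A 0) + (T 1 - D 1) * (T 1 - A 1)) := by
      rw [e3]; exact mul_pos (by linarith) e2
    exact pos_of_mul_pos_right e4 (by positivity)
  -- T'
  obtain ⟨κ, hk0, hk1⟩ := mem_line _ _ _ hT'
  obtain ⟨P, hP, hP0, hP1⟩ := line_mem A T (1 / t)
  obtain ⟨k, hk⟩ : ∃ k, k = 1 / t := ⟨_, rfl⟩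
  have hkt : k * t = 1 := by rw [hk]; field_simp
  have hkpos : 0 < k := by rw [hk]; positivity
  rw [← hk] at hP0 hP1
  have j0 : P 0 - I 0 = k * (T 0 - D 0) := by
    rw [hP0, hD0]; linear_combination (I 0 - A 0) * hkt
  have j1 : P 1 - I 1 = k * (T 1 - D 1) := by
    rw [hP1, hD1]; linear_combination (I 1 - A 1) * hkt
  have hPI2 : (P 0 - I 0) ^ 2 + (P 1 - I 1) ^ 2 = r ^ 2 := by
    rw [j0, j1]; linear_combination (-k ^ 2) * qTD + r ^ 2 * (k * t + 1) * hkt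
  have hPI : dist I P = r := by
    apply (sq_eq_sq₀ dist_nonneg hr.le).1
    rw [dsq]; linear_combination hPI2
  have hle := hT'far P hP hPI
  have hle2 : dist A P ^ 2 ≤ dist A T' ^ 2 := by gcongr
  rw [dsq, dsq, hP0, hP1, hk0, hk1] at hle2
  have qIT := dsq I T'
  rw [hT'I, hk0, hk1] at qIT
  obtain ⟨N, hN⟩ : ∃ N, N = (T 0 - A 0) ^ 2 + (T 1 - A 1) ^ 2 := ⟨_, rfl⟩
  have hNpos : 0 < N := by
    rcases lt_or_eq_of_le (show 0 ≤ N by rw [hN]; positivity) with h | h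
    · exact h
    · exfalso
      rw [hN] at h
      obtain ⟨e0, e1⟩ := sumsq_zero _ _ h.symm
      rw [e0, e1] at hfar; linarith
  have hAI : r ^ 2 ≤ (I 0 - A 0) ^ 2 + (I 1 - A 1) ^ 2 := by
    have h1 : r ≤ dist I A := hIab ▸ Metric.infDist_le_dist_of_mem (left_mem_affineSpan_pair ℝ A B)
    rw [← dsq]; gcongr
  have hκ : κ = k := by
    by_contra hne
    have hne' : κ - k ≠ 0 := sub_ne_zero.2 hne
    have e1 : (κ - k) * N + 2 * k * ((T 0 - D 0) * (T 0 - A 0) + (T 1 - D 1) * (T 1 - A 1)) = 0 := by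
      apply mul_left_cancel₀ hne'
      have : 2 * k * ((T 0 - D 0) * (T 0 - A 0) + (T 1 - D 1) * (T 1 - A 1))
        = 2 * ((P 0 - I 0) * (T 0 - A 0) + (P 1 - I 1) * (T 1 - A 1)) := by rw [j0, j1]; ring
      rw [this, hN]
      rw [hP0, hP1] at hPI2 ⊢
      linear_combination -hPI2 - qIT
    have e2 : κ < k := by
      have := mul_pos hkpos hfar
      by_contra h
      have := mul_nonneg (sub_nonneg.2 (not_lt.1 h)) hNpos.le
      linarith
    have e3 : k ^ 2 * N ≤ κ ^ 2 * N := by rw [hN]; linarith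
    have e4 : k ^ 2 ≤ κ ^ 2 := le_of_mul_le_mul_right e3 hNpos
    have e5 : κ < 0 := by
      by_contra h
      have h' := not_lt.1 h
      have := mul_pos (sub_pos.2 e2) (show 0 < k + κ by linarith)
      linarith
    have e6 : κ * k * N = (I 0 - A 0) ^ 2 + (I 1 - A 1) ^ 2 - r ^ 2 := by
      apply mul_left_cancel₀ hne'
      rw [hN]
      rw [hP0, hP1] at hPI2
      linear_combination (-k) * qIT - κ * hPI2
    have e7 : 0 < -κ * k * N := mul_pos (mul_pos (neg_pos.2 e5) hkpos) hNpos
    linarith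
  apply (sq_eq_sq₀ dist_nonneg dist_nonneg).1
  rw [dsq, dsq, hk0, hk1, hκ]
  apply mul_left_cancel₀ (pow_pos ht0 2).ne'
  rw [key]
  linear_combination (-((T 0 - A 0) ^ 2 + (T 1 - A 1) ^ 2)) * (k * t + 1 - 2 * t) * hkt
end

section
/- Then ∠APC = ∠DPB. -/
open EuclideanGeometry Real RealInnerProductSpace Affine

/-- Two circles `C₁` (center `O₁`, radius `r₁`) and `C₂` (center `O₂`, radius `r₂`)
are internally tangent at `P`, with `C₂` inside `C₁`.  A line meets `C₁` at `A`, `B`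
and `C₂` at `C`, `D`, the points occurring in the order `A`, `C`, `D`, `B`, with `P`
not on the line.  Then `∠ A P C = ∠ D P B`. -/
theorem internally_tangent_equal_angles
    (O₁ O₂ P A B C D : Plane) (r₁ r₂ : ℝ)
    (hr₂ : 0 < r₂) (hr₁₂ : r₂ < r₁)
    (htan : dist O₁ O₂ = r₁ - r₂)
    (hP₁ : dist P O₁ = r₁) (hP₂ : dist P O₂ = r₂)
    (hA : dist A O₁ = r₁) (hB : dist B O₁ = r₁)
    (hC : dist C O₂ = r₂) (hD : dist D O₂ = r₂)
    (hord₁ : Sbtw ℝ A C D) (hord₂ : Sbtw ℝ C D B)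
    (hP : P ∉ affineSpan ℝ ({A, B} : Set Plane)) :
    ∠ A P C = ∠ D P B := by
  obtain ⟨⟨s, ⟨hs0, hs1⟩, hsC⟩, hCA, hCD⟩ := hord₁
  obtain ⟨⟨t, ⟨ht0, ht1⟩, htD⟩, hDC, hDB⟩ := hord₂
  have hs1' : s ≠ 1 := by
    rintro rfl; apply hCD; rw [← hsC]; simp
  have hs0' : s ≠ 0 := by
    rintro rfl; apply hCA; rw [← hsC]; simp
  have ht1' : t ≠ 1 := by
    rintro rfl; apply hDB; rw [← htD]; simp
  have ht0' : t ≠ 0 := by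
    rintro rfl; apply hDC; rw [← htD]; simp
  have hs1 : 0 < 1 - s := by
    have := lt_of_le_of_ne hs1 hs1'
    linarith
  have hs0 : 0 < s := lt_of_le_of_ne hs0 (Ne.symm hs0')
  have ht0 : 0 < t := lt_of_le_of_ne ht0 (Ne.symm ht0')
  have ht1 : t < 1 := lt_of_le_of_ne ht1 ht1'
  obtain ⟨α, hα, hαs⟩ : ∃ α : ℝ, 0 < α ∧ α * (1 - s) = s :=
    ⟨s / (1 - s), by positivity, by field_simp⟩
  obtain ⟨γ, hγ, hγt⟩ : ∃ γ : ℝ, 0 < γ ∧ (1 + γ) * t = 1 :=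
    ⟨1 / t - 1, by rw [sub_pos, lt_div_iff₀ ht0]; linarith, by field_simp; ring⟩
  have hdir : D - C ≠ 0 := sub_ne_zero.mpr hDC
  have eA : A - P = (C - P) - α • (D - C) := by
    ext i
    have h := congrArg (fun x : Plane => x i) hsC
    simp [AffineMap.lineMap_apply] at h ⊢
    apply mul_left_cancel₀ hs1.ne'
    linear_combination h + (D i - C i) * hαs
  have eB : B - P = (C - P) + (1 + γ) • (D - C) := by
    ext i
    have h := congrArg (fun x : Plane => x i) htD
    simp [AffineMap.lineMap_apply] at h ⊢
    linear_combination (1 + γ) * h - (B i - C i) * hγt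
  have eD : D - P = (C - P) + (D - C) := by abel
  generalize hv : D - C = v at *
  generalize hc : C - P = c at *
  have hr₁ : 0 < r₁ := hr₂.trans hr₁₂
  obtain ⟨o, ho⟩ : ∃ o, O₁ - P = o := ⟨_, rfl⟩
  obtain ⟨o', ho'⟩ : ∃ o, O₂ - P = o := ⟨_, rfl⟩
  have no : inner ℝ o o = r₁ ^ 2 := by
    rw [real_inner_self_eq_norm_sq, ← ho, ← dist_eq_norm, dist_comm, hP₁]
  have no' : inner ℝ o' o' = r₂ ^ 2 := by
    rw [real_inner_self_eq_norm_sq, ← ho', ← dist_eq_norm, dist_comm, hP₂]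
  have noo : inner ℝ (o - o') (o - o') = (r₁ - r₂) ^ 2 := by
    rw [real_inner_self_eq_norm_sq, ← ho, ← ho', sub_sub_sub_cancel_right, ← dist_eq_norm, htan]
  have key : r₁ • o' = r₂ • o := by
    rw [← sub_eq_zero, ← inner_self_eq_zero (𝕜 := ℝ)]
    simp only [inner_sub_left, inner_sub_right, real_inner_smul_left, real_inner_smul_right] at noo ⊢
    rw [real_inner_comm o o'] at *
    linear_combination (r₁^2 - r₁ * r₂) * no' + (r₂^2 - r₁ * r₂) * no + r₁ * r₂ * noo
  have circ : ∀ (X O : Plane) (r : ℝ), dist X O = r → dist P O = r →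
      inner ℝ (X - P) (X - P) = 2 * inner ℝ (X - P) (O - P) := by
    intro X O r h1 h2
    have h3 : inner ℝ ((X - P) - (O - P)) ((X - P) - (O - P)) = inner ℝ (O - P) (O - P) := by
      rw [real_inner_self_eq_norm_sq, real_inner_self_eq_norm_sq, sub_sub_sub_cancel_right,
        ← dist_eq_norm, ← dist_eq_norm, h1, dist_comm, h2]
    simp only [inner_sub_left (X - P), inner_sub_left (𝕜 := ℝ) (X - P) (O - P),
      inner_sub_right (𝕜 := ℝ) _ (X - P) (O - P)] at h3
    rw [real_inner_comm (X - P) (O - P)] at h3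
    linarith
  have qA := circ A O₁ r₁ hA hP₁
  have qB := circ B O₁ r₁ hB hP₁
  have qC := circ C O₂ r₂ hC hP₂
  have qD := circ D O₂ r₂ hD hP₂
  rw [eA, ho] at qA
  rw [eB, ho] at qB
  rw [hc, ho'] at qC
  rw [eD, ho'] at qD
  have kc : r₁ * inner ℝ c o' = r₂ * inner ℝ c o := by
    rw [← real_inner_smul_right, key, real_inner_smul_right]
  have kv : r₁ * inner ℝ v o' = r₂ * inner ℝ v o := by
    rw [← real_inner_smul_right, key, real_inner_smul_right]
  have hV : inner ℝ v v ≠ (0:ℝ) := by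
    simpa [inner_self_eq_zero] using hdir
  have hvc : inner ℝ v c = inner ℝ c v := real_inner_comm _ _
  have hx : γ * inner ℝ (c - α • v) c = α * inner ℝ (c + v) (c + (1 + γ) • v) := by
    simp only [inner_sub_left, inner_sub_right, inner_add_left, inner_add_right,
      real_inner_smul_left, real_inner_smul_right, hvc] at qA qB qC qD ⊢
    generalize (inner ℝ c c : ℝ) = N at *
    generalize (inner ℝ c v : ℝ) = X at *
    generalize (inner ℝ v v : ℝ) = V at *
    generalize (inner ℝ c o : ℝ) = co at *
    generalize (inner ℝ v o : ℝ) = vo at *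
    generalize (inner ℝ c o' : ℝ) = co' at *
    generalize (inner ℝ v o' : ℝ) = vo' at *
    have e1 : 2 * vo = 2 * X + (1 + γ - α) * V := by
      apply mul_left_cancel₀ (show α + 1 + γ ≠ 0 by positivity)
      linear_combination qA - qB
    have e2 : 2 * co = N + α * (1 + γ) * V := by
      linear_combination α * e1 - qA
    have e3 : 2 * vo' = 2 * X + V := by linear_combination qC - qD
    have e4 : r₁ * N = r₂ * (N + α * (1 + γ) * V) := by
      linear_combination r₁ * qC + 2 * kc + r₂ * e2
    have e5 : r₁ * (2 * X + V) = r₂ * (2 * X + (1 + γ - α) * V) := by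
      linear_combination (-r₁) * e3 + 2 * kv + r₂ * e1
    have e6 : N * (2 * X + (1 + γ - α) * V) = (2 * X + V) * (N + α * (1 + γ) * V) := by
      apply mul_left_cancel₀ (mul_pos hr₁ hr₂).ne'
      linear_combination r₂ * (2 * X + (1 + γ - α) * V) * e4 - r₂ * (N + α * (1 + γ) * V) * e5
    apply mul_left_cancel₀ hV
    linear_combination e6
  have hn : γ * (‖c - α • v‖ * ‖c‖) = α * (‖c + v‖ * ‖c + (1 + γ) • v‖) := by
    rw [← sq_eq_sq₀ (by positivity) (by positivity)]
    simp only [mul_pow, ← real_inner_self_eq_norm_sq]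
    simp only [inner_sub_left, inner_sub_right, inner_add_left, inner_add_right,
      real_inner_smul_left, real_inner_smul_right, hvc] at hx ⊢
    generalize (inner ℝ c c : ℝ) = N at *
    generalize (inner ℝ c v : ℝ) = X at *
    generalize (inner ℝ v v : ℝ) = V at *
    linear_combination (γ * (N - α * X) + α * (N + X + (1 + γ) * (X + V))) * hx
  have hgoal : InnerProductGeometry.angle (A - P) (C - P) =
      InnerProductGeometry.angle (D - P) (B - P) := by
    rw [eA, eB, eD, hc]
    unfold InnerProductGeometry.angle
    rw [← mul_div_mul_left _ _ hγ.ne', hx, hn, mul_div_mul_left _ _ hα.ne']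
  exact hgoal
end
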